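/- (Kim's lemma for canonical Morley sequences) Let T be NSOP₂, M a small elementary submodel of 𝕄, b a tuple, φ(x,y) a formula over M, and q a canonical coheir of tp(b/M). Suppose some canonical Morley sequence in q starting with b witnesses Kim-dividing of φ(x,b) over M with {φ(x,b_i)} k-inconsistent. Then there is a finite bound N, depending only on φ(x,y) and k, such that every coheir sequence b₁,…,b_n over M of realizations of tp(b/M) for which {φ(x,b_i) : 1≤i≤n} is consistent has n ≤ N. In particular, every coheir Morley sequence over M starting with b witnesses Kim-dividing of φ(x,b) over M. -/

import Mathlib

/- Common model-theoretic infrastructure for formalizing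
   "NSOP₂ theories are NSOP₁" (arXiv:2206.08512).

   We work with a monster model `𝕄` of a complete theory: a sufficiently
   saturated and strongly homogeneous `L`-structure.  Tuples are functions
   `α → 𝕄`; sets of formulas with parameters are coded via `FmlP`. -/

open FirstOrder Language

universe u v w

namespace NSOP2Paper

/-- A first-order formula in free variables `α ⊕ Fin n` together with an
`n`-tuple of parameters from `𝕄`. -/
abbrev FmlP (L : FirstOrder.Language.{u, u}) (𝕄 : Type u) (α : Type v) :=
  Σ n : ℕ, L.Formula (α ⊕ Fin n) × (Fin n → 𝕄)

/-- `a ≡_C b` : the tuples `a` and `b` satisfy the same formulas with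
parameters from `C`. -/
def EqTpOver (L : FirstOrder.Language.{u, u}) {𝕄 : Type u} [L.Structure 𝕄] (C : Set 𝕄)
    {α : Type v} (a b : α → 𝕄) : Prop :=
  ∀ (n : ℕ) (φ : L.Formula (α ⊕ Fin n)) (c : Fin n → 𝕄), (∀ i, c i ∈ C) →
    (φ.Realize (Sum.elim a c) ↔ φ.Realize (Sum.elim b c))

/-- `tp(a / C)` is finitely satisfiable in `Ms`: every formula over `C`
satisfied by `a` has a realization by a tuple from `Ms`. -/
def FinSatIn (L : FirstOrder.Language.{u, u}) {𝕄 : Type u} [L.Structure 𝕄] (Ms : Set 𝕄)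
    {α : Type v} (a : α → 𝕄) (C : Set 𝕄) : Prop :=
  ∀ (n : ℕ) (φ : L.Formula (α ⊕ Fin n)) (c : Fin n → 𝕄), (∀ i, c i ∈ C) →
    φ.Realize (Sum.elim a c) →
    ∃ m : α → 𝕄, (∀ i, m i ∈ Ms) ∧ φ.Realize (Sum.elim m c)

/-- `Ms` is the underlying set of a (small) elementary submodel of `𝕄`. -/
def IsElemSubmodel (L : FirstOrder.Language.{u, u}) {𝕄 : Type u} [L.Structure 𝕄] (Ms : Set 𝕄) : Prop :=
  ∃ S : L.ElementarySubstructure 𝕄, (S : Set 𝕄) = Ms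

/-- A complete consistent global type (a complete type over the monster `𝕄`)
in variables `α`, coded as the set of formulas-with-parameters it contains. -/
structure GlobalType (L : FirstOrder.Language.{u, u}) (𝕄 : Type u) [L.Structure 𝕄] (α : Type v) where
  carrier : Set (FmlP L 𝕄 α)
  consistent : ∀ t : Finset (FmlP L 𝕄 α), ↑t ⊆ carrier →
    ∃ a : α → 𝕄, ∀ p ∈ t, p.2.1.Realize (Sum.elim a p.2.2)
  complete : ∀ (n : ℕ) (φ : L.Formula (α ⊕ Fin n)) (c : Fin n → 𝕄),
    (⟨n, (φ, c)⟩ : FmlP L 𝕄 α) ∈ carrier ∨ (⟨n, (φ.not, c)⟩ : FmlP L 𝕄 α) ∈ carrier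

variable {L : FirstOrder.Language.{u, u}} {𝕄 : Type u} [L.Structure 𝕄]

/-- The global type `q` is finitely satisfiable in `Ms` (i.e. it is a coheir of
its restriction to `Ms`). -/
def GlobalType.FinSatInM {α : Type v} (q : GlobalType L 𝕄 α) (Ms : Set 𝕄) : Prop :=
  ∀ t : Finset (FmlP L 𝕄 α), ↑t ⊆ q.carrier →
    ∃ m : α → 𝕄, (∀ i, m i ∈ Ms) ∧ ∀ p ∈ t, p.2.1.Realize (Sum.elim m p.2.2)

/-- `a ⊨ q|_C` : the tuple `a` realizes the restriction of the global type `q`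
to parameters from `C`. -/
def RealizesType {α : Type v} (q : GlobalType L 𝕄 α) (a : α → 𝕄) (C : Set 𝕄) : Prop :=
  ∀ (n : ℕ) (φ : L.Formula (α ⊕ Fin n)) (c : Fin n → 𝕄), (∀ i, c i ∈ C) →
    (⟨n, (φ, c)⟩ : FmlP L 𝕄 α) ∈ q.carrier → φ.Realize (Sum.elim a c)

/-- The global type `q` extends `tp(a / C)`. -/
def ExtendsTpOver {α : Type v} (q : GlobalType L 𝕄 α) (C : Set 𝕄) (a : α → 𝕄) : Prop :=
  ∀ (n : ℕ) (φ : L.Formula (α ⊕ Fin n)) (c : Fin n → 𝕄), (∀ i, c i ∈ C) →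
    φ.Realize (Sum.elim a c) → (⟨n, (φ, c)⟩ : FmlP L 𝕄 α) ∈ q.carrier

/-- `B` is a coheir Morley sequence over `Ms` in the global type `q`:
`q` is finitely satisfiable in `Ms` and `B i ⊨ q|_(Ms ∪ B_{<i})`. -/
def MorleyIn {α : Type v} (q : GlobalType L 𝕄 α) (Ms : Set 𝕄) (B : ℕ → α → 𝕄) : Prop :=
  q.FinSatInM Ms ∧
    ∀ i : ℕ, RealizesType q (B i) (Ms ∪ ⋃ (j : ℕ) (_ : j < i), Set.range (B j))

/-- `B` is a coheir Morley sequence over `Ms`. -/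
def CoheirMorley (L : FirstOrder.Language.{u, u}) {𝕄 : Type u} [L.Structure 𝕄] (Ms : Set 𝕄)
    {α : Type v} (B : ℕ → α → 𝕄) : Prop :=
  ∃ q : GlobalType L 𝕄 α, MorleyIn q Ms B

/-- Flatten an `ℕ`-indexed sequence of `α`-tuples into a single tuple. -/
def flatSeq {α : Type v} (I : ℕ → α → 𝕄) : ℕ × α → 𝕄 := fun p => I p.1 p.2

/-- The sequence `I` is indiscernible over `C`. -/
def IndiscernibleOver (L : FirstOrder.Language.{u, u}) {𝕄 : Type u} [L.Structure 𝕄] (C : Set 𝕄)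
    {α : Type v} (I : ℕ → α → 𝕄) : Prop :=
  ∀ (n : ℕ) (f g : Fin n → ℕ), StrictMono f → StrictMono g →
    EqTpOver L C (fun p : Fin n × α => I (f p.1) p.2) (fun p : Fin n × α => I (g p.1) p.2)

/-- `𝕄` is `κ`-saturated: every finitely satisfiable set of formulas in fewer
than `κ` variables over a parameter set of size `< κ` is realized in `𝕄`. -/
def IsSaturated (L : FirstOrder.Language.{u, u}) (𝕄 : Type u) [L.Structure 𝕄] (κ : Cardinal.{u}) : Prop :=
  ∀ (α : Type u) (A : Set 𝕄), Cardinal.mk α < κ → Cardinal.mk A < κ →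
    ∀ Γ : Set (FmlP L 𝕄 α), (∀ p ∈ Γ, ∀ i, p.2.2 i ∈ A) →
      (∀ t : Finset (FmlP L 𝕄 α), ↑t ⊆ Γ →
        ∃ a : α → 𝕄, ∀ p ∈ t, p.2.1.Realize (Sum.elim a p.2.2)) →
      ∃ a : α → 𝕄, ∀ p ∈ Γ, p.2.1.Realize (Sum.elim a p.2.2)

/-- `𝕄` is strongly `κ`-homogeneous: partial elementary maps between tuples of
length `< κ` extend to automorphisms of `𝕄`. -/
def IsStronglyHomogeneous (L : FirstOrder.Language.{u, u}) (𝕄 : Type u) [L.Structure 𝕄]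
    (κ : Cardinal.{u}) : Prop :=
  ∀ (α : Type u), Cardinal.mk α < κ → ∀ a b : α → 𝕄, EqTpOver L (∅ : Set 𝕄) a b →
    ∃ σ : 𝕄 ≃[L] 𝕄, ∀ i, σ (a i) = b i

/-- `𝕄` is a monster model (for smallness degree `κ`): sufficiently saturated
and strongly homogeneous. -/
def IsMonster (L : FirstOrder.Language.{u, u}) (𝕄 : Type u) [L.Structure 𝕄] (κ : Cardinal.{u}) : Prop :=
  Cardinal.aleph0 < κ ∧ IsSaturated L 𝕄 κ ∧ IsStronglyHomogeneous L 𝕄 κ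

/-! ### Tree combinatorics -/

/-- The meet (longest common prefix) of two finite sequences. -/
def meet {A : Type w} [DecidableEq A] : List A → List A → List A
  | a :: as, b :: bs => if a = b then a :: meet as bs else []
  | _, _ => []

/-- The meet of `η 0, …, η i`. -/
def combMeet {A : Type w} [DecidableEq A] {k : ℕ} (η : Fin k → List A) (i : Fin k) : List A :=
  (List.ofFn fun j : Fin i.val => η (Fin.castLE i.2.le j)).foldl meet (η i)

/-- `η 0, …, η (k-1)` is a descending comb: a lexicographically increasing
antichain such that the meet of `η 0, …, η (i+1)` is a proper initial segment
of the meet of `η 0, …, η i`. -/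
def DescendingComb {A : Type w} [DecidableEq A] [LT A] {k : ℕ} (η : Fin k → List A) : Prop :=
  (∀ i j : Fin k, i ≠ j → ¬ η i <+: η j) ∧
  (∀ i j : Fin k, i < j → List.Lex (· < ·) (η i) (η j)) ∧
  (∀ (i : ℕ) (h : i + 1 < k),
    combMeet η ⟨i + 1, h⟩ <+: combMeet η ⟨i, by omega⟩ ∧
    combMeet η ⟨i + 1, h⟩ ≠ combMeet η ⟨i, by omega⟩)

/-! ### Tree properties of theories (witnessed in the monster model) -/

/-- `T = Th(𝕄)` has `SOP₁`. -/
def HasSOP1 (L : FirstOrder.Language.{u, u}) (𝕄 : Type u) [L.Structure 𝕄] : Prop :=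
  ∃ (k m : ℕ) (φ : L.Formula (Fin k ⊕ Fin m)) (b : List Bool → Fin m → 𝕄),
    (∀ σ : ℕ → Bool, ∃ a : Fin k → 𝕄,
      ∀ n : ℕ, φ.Realize (Sum.elim a (b (List.ofFn fun i : Fin n => σ i)))) ∧
    ∀ η₁ η₂ : List Bool, (η₁ ++ [false]) <+: η₂ →
      ¬ ∃ a : Fin k → 𝕄, φ.Realize (Sum.elim a (b η₂)) ∧
        φ.Realize (Sum.elim a (b (η₁ ++ [true])))

/-- `T = Th(𝕄)` has `SOP₂`. -/
def HasSOP2 (L : FirstOrder.Language.{u, u}) (𝕄 : Type u) [L.Structure 𝕄] : Prop :=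
  ∃ (k m : ℕ) (φ : L.Formula (Fin k ⊕ Fin m)) (b : List Bool → Fin m → 𝕄),
    (∀ σ : ℕ → Bool, ∃ a : Fin k → 𝕄,
      ∀ n : ℕ, φ.Realize (Sum.elim a (b (List.ofFn fun i : Fin n => σ i)))) ∧
    ∀ η₁ η₂ : List Bool, ¬ η₁ <+: η₂ → ¬ η₂ <+: η₁ →
      ¬ ∃ a : Fin k → 𝕄, φ.Realize (Sum.elim a (b η₁)) ∧ φ.Realize (Sum.elim a (b η₂))

/-- `T = Th(𝕄)` has `k`-`DCTP₁`: paths are consistent but descending combs of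
size `k` are inconsistent. -/
def HasKDCTP1 (L : FirstOrder.Language.{u, u}) (𝕄 : Type u) [L.Structure 𝕄] (k : ℕ) : Prop :=
  ∃ (r m : ℕ) (φ : L.Formula (Fin r ⊕ Fin m)) (b : List ℕ → Fin m → 𝕄),
    (∀ σ : ℕ → ℕ, ∃ a : Fin r → 𝕄,
      ∀ n : ℕ, φ.Realize (Sum.elim a (b (List.ofFn fun i : Fin n => σ i)))) ∧
    ∀ η : Fin k → List ℕ, DescendingComb η →
      ¬ ∃ a : Fin r → 𝕄, ∀ i, φ.Realize (Sum.elim a (b (η i)))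

/-- `T = Th(𝕄)` has weak `k`-`TP₁`: paths are consistent but any `k` pairwise
incomparable nodes with common pairwise meet are inconsistent. -/
def HasWeakKTP1 (L : FirstOrder.Language.{u, u}) (𝕄 : Type u) [L.Structure 𝕄] (k : ℕ) : Prop :=
  ∃ (r m : ℕ) (φ : L.Formula (Fin r ⊕ Fin m)) (b : List ℕ → Fin m → 𝕄),
    (∀ σ : ℕ → ℕ, ∃ a : Fin r → 𝕄,
      ∀ n : ℕ, φ.Realize (Sum.elim a (b (List.ofFn fun i : Fin n => σ i)))) ∧
    ∀ η : Fin k → List ℕ,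
      (∀ i j, i ≠ j → ¬ η i <+: η j) →
      (∀ i j i' j' : Fin k, i ≠ j → i' ≠ j' → meet (η i) (η j) = meet (η i') (η j')) →
      ¬ ∃ a : Fin r → 𝕄, ∀ i, φ.Realize (Sum.elim a (b (η i)))

/-- `T = Th(𝕄)` has `k`-`DCTP₂`: paths are `k`-inconsistent but descending
combs are consistent. -/
def HasKDCTP2 (L : FirstOrder.Language.{u, u}) (𝕄 : Type u) [L.Structure 𝕄] (k : ℕ) : Prop :=
  ∃ (r m : ℕ) (φ : L.Formula (Fin r ⊕ Fin m)) (b : List Bool → Fin m → 𝕄),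
    (∀ σ : ℕ → Bool, ∀ s : Finset ℕ, s.card = k →
      ¬ ∃ a : Fin r → 𝕄, ∀ n ∈ s,
        φ.Realize (Sum.elim a (b (List.ofFn fun i : Fin n => σ i)))) ∧
    ∀ (l : ℕ) (η : Fin l → List Bool), DescendingComb η →
      ∃ a : Fin r → 𝕄, ∀ i, φ.Realize (Sum.elim a (b (η i)))

/-! ### Kim-dividing and Conant-dividing, with respect to coheir Morley sequences -/

/-- `φ(x, b)` Kim-divides over `Ms`: some coheir Morley sequence over `Ms`
starting with `b` makes it inconsistent. -/
def KimDivides (L : FirstOrder.Language.{u, u}) {𝕄 : Type u} [L.Structure 𝕄] (Ms : Set 𝕄)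
    {α : Type v} {n : ℕ} (φ : L.Formula (α ⊕ Fin n)) (b : Fin n → 𝕄) : Prop :=
  ∃ B : ℕ → Fin n → 𝕄, CoheirMorley L Ms B ∧ B 0 = b ∧
    ¬ ∃ a : α → 𝕄, ∀ i, φ.Realize (Sum.elim a (B i))

/-- `φ(x, b)` Kim-forks over `Ms`: it implies a finite disjunction of formulas
Kim-dividing over `Ms`. -/
def KimForks (L : FirstOrder.Language.{u, u}) {𝕄 : Type u} [L.Structure 𝕄] (Ms : Set 𝕄)
    {α : Type v} {n : ℕ} (φ : L.Formula (α ⊕ Fin n)) (b : Fin n → 𝕄) : Prop :=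
  ∃ (N : ℕ) (m : Fin N → ℕ) (ψ : ∀ j : Fin N, L.Formula (α ⊕ Fin (m j)))
    (c : ∀ j : Fin N, Fin (m j) → 𝕄),
    (∀ j, KimDivides L Ms (ψ j) (c j)) ∧
    ∀ a : α → 𝕄, φ.Realize (Sum.elim a b) → ∃ j, (ψ j).Realize (Sum.elim a (c j))

/-- `φ(x, b)` Conant-divides over `Ms`: every coheir Morley sequence over `Ms`
starting with `b` makes it inconsistent. -/
def ConantDivides (L : FirstOrder.Language.{u, u}) {𝕄 : Type u} [L.Structure 𝕄] (Ms : Set 𝕄)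
    {α : Type v} {n : ℕ} (φ : L.Formula (α ⊕ Fin n)) (b : Fin n → 𝕄) : Prop :=
  ∀ B : ℕ → Fin n → 𝕄, CoheirMorley L Ms B → B 0 = b →
    ¬ ∃ a : α → 𝕄, ∀ i, φ.Realize (Sum.elim a (B i))

/-- `φ(x, b)` Conant-forks over `Ms`. -/
def ConantForks (L : FirstOrder.Language.{u, u}) {𝕄 : Type u} [L.Structure 𝕄] (Ms : Set 𝕄)
    {α : Type v} {n : ℕ} (φ : L.Formula (α ⊕ Fin n)) (b : Fin n → 𝕄) : Prop :=
  ∃ (N : ℕ) (m : Fin N → ℕ) (ψ : ∀ j : Fin N, L.Formula (α ⊕ Fin (m j)))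
    (c : ∀ j : Fin N, Fin (m j) → 𝕄),
    (∀ j, ConantDivides L Ms (ψ j) (c j)) ∧
    ∀ a : α → 𝕄, φ.Realize (Sum.elim a b) → ∃ j, (ψ j).Realize (Sum.elim a (c j))

/-- `a ⫝^{K*}_{Ms} b` : `tp(a/Ms b)` contains no formula Conant-forking
over `Ms`. -/
def ConantIndep (L : FirstOrder.Language.{u, u}) {𝕄 : Type u} [L.Structure 𝕄] (Ms : Set 𝕄)
    {α : Type v} {β : Type w} (a : α → 𝕄) (b : β → 𝕄) : Prop :=
  ∀ (n : ℕ) (φ : L.Formula (α ⊕ Fin n)) (d : Fin n → 𝕄),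
    (∀ i, d i ∈ Ms ∪ Set.range b) → φ.Realize (Sum.elim a d) →
    ¬ ConantForks L Ms φ d

/-! ### Abstract independence relations between sets over models -/

/-- An abstract ternary relation `A ⫝_M B` between subsets of `𝕄` over
(elementary submodels of) `𝕄`. -/
structure IndRel (L : FirstOrder.Language.{u, u}) (𝕄 : Type u) [L.Structure 𝕄] where
  rel : Set 𝕄 → Set 𝕄 → Set 𝕄 → Prop

/-- A set `S` of `α`-tuples is type-definable over `C`. -/
def TypeDefinableOver (L : FirstOrder.Language.{u, u}) {𝕄 : Type u} [L.Structure 𝕄] (C : Set 𝕄)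
    {γ : Type v} (S : Set (γ → 𝕄)) : Prop :=
  ∃ Γ : Set (FmlP L 𝕄 γ), (∀ p ∈ Γ, ∀ i, p.2.2 i ∈ C) ∧
    ∀ g : γ → 𝕄, g ∈ S ↔ ∀ p ∈ Γ, p.2.1.Realize (Sum.elim g p.2.2)

namespace IndRel


/-- Invariance under automorphisms of `𝕄`. -/
def Invariant (R : IndRel L 𝕄) : Prop :=
  ∀ (σ : 𝕄 ≃[L] 𝕄) (A Ms B : Set 𝕄), R.rel A Ms B →
    R.rel ((⇑σ) '' A) ((⇑σ) '' Ms) ((⇑σ) '' B)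

/-- Monotonicity (on both sides). -/
def Mono (R : IndRel L 𝕄) : Prop :=
  ∀ (A A' Ms B B' : Set 𝕄), IsElemSubmodel L Ms → R.rel A Ms B →
    Ms ⊆ A' → A' ⊆ A → Ms ⊆ B' → B' ⊆ B → R.rel A' Ms B'

/-- Existence: for `M ⊆ A, B` there is `A' ≡_M A` with `A' ⫝_M B`. -/
def Existence (R : IndRel L 𝕄) (κ : Cardinal.{u}) : Prop :=
  ∀ (Ms : Set 𝕄), IsElemSubmodel L Ms → Cardinal.mk Ms < κ →
    ∀ (α β : Type u), Cardinal.mk α < κ → Cardinal.mk β < κ →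
      ∀ (a : α → 𝕄) (b : β → 𝕄),
        ∃ a' : α → 𝕄, EqTpOver L Ms a' a ∧
          R.rel (Ms ∪ Set.range a') Ms (Ms ∪ Set.range b)

/-- Right extension. -/
def RightExt (R : IndRel L 𝕄) (κ : Cardinal.{u}) : Prop :=
  ∀ (Ms : Set 𝕄), IsElemSubmodel L Ms → Cardinal.mk Ms < κ →
    ∀ (α : Type u), Cardinal.mk α < κ → ∀ (a : α → 𝕄) (B C : Set 𝕄),
      Cardinal.mk B < κ → Cardinal.mk C < κ →
      R.rel (Set.range a) Ms B → B ⊆ C →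
      ∃ a' : α → 𝕄, EqTpOver L B a' a ∧ R.rel (Set.range a') Ms C

/-- Quasi-strong finite character: for complete types `p = tp(a₀/Ms)` and
`q = tp(b₀/Ms)`, the set of pairs of realizations `(a, b)` with `a ⫝_Ms b`
is type-definable over `Ms`. -/
def QSFC (R : IndRel L 𝕄) (κ : Cardinal.{u}) : Prop :=
  ∀ (Ms : Set 𝕄), IsElemSubmodel L Ms → Cardinal.mk Ms < κ →
    ∀ (α β : Type u), Cardinal.mk α < κ → Cardinal.mk β < κ →
      ∀ (a₀ : α → 𝕄) (b₀ : β → 𝕄),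
        TypeDefinableOver L Ms {g : (α ⊕ β) → 𝕄 |
          EqTpOver L Ms (g ∘ Sum.inl) a₀ ∧ EqTpOver L Ms (g ∘ Sum.inr) b₀ ∧
          R.rel (Set.range (g ∘ Sum.inl)) Ms (Set.range (g ∘ Sum.inr))}

/-- The coheir chain condition. -/
def CoheirChain (R : IndRel L 𝕄) (κ : Cardinal.{u}) : Prop :=
  ∀ (Ms : Set 𝕄), IsElemSubmodel L Ms → Cardinal.mk Ms < κ →
    ∀ (α β : Type u), Cardinal.mk α < κ → Cardinal.mk β < κ →
      ∀ (a : α → 𝕄) (b : β → 𝕄), R.rel (Set.range a) Ms (Set.range b) →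
        ∀ I : ℕ → β → 𝕄, CoheirMorley L Ms I → I 0 = b →
          ∃ I' : ℕ → β → 𝕄, EqTpOver L Ms (flatSeq I') (flatSeq I) ∧
            R.rel (Set.range a) Ms (⋃ i, Set.range (I' i)) ∧
            ∀ i, EqTpOver L (Ms ∪ Set.range a) (I' i) b

/-- `R` implies `⫝ʰ` : `A ⫝_M B` implies `tp(B / M A)` is finitely
satisfiable in `M`. -/
def StrongerThanH (R : IndRel L 𝕄) : Prop :=
  ∀ (A Ms B : Set 𝕄), IsElemSubmodel L Ms → R.rel A Ms B →
    FinSatIn L Ms (fun x : B => (x : 𝕄)) (Ms ∪ A)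

end IndRel

/-- The axioms satisfied by the relations among which `⫝^CK` is weakest. -/
def GoodRel (R : IndRel L 𝕄) (κ : Cardinal.{u}) : Prop :=
  R.StrongerThanH ∧ R.Invariant ∧ R.Mono ∧ R.Existence κ ∧ R.RightExt κ ∧ R.CoheirChain κ

/-- `R` is `⫝^CK` : the weakest relation implying `⫝ʰ` and satisfying
invariance, monotonicity, existence, right extension and the coheir chain
condition. -/
def IsCK (R : IndRel L 𝕄) (κ : Cardinal.{u}) : Prop :=
  GoodRel R κ ∧ ∀ R' : IndRel L 𝕄, GoodRel R' κ →
    ∀ A Ms B : Set 𝕄, R'.rel A Ms B → R.rel A Ms B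

/-- `q` is a canonical global type over `Ms` (w.r.t. the relation `R = ⫝^CK`):
whenever `c ⊨ q|_{Ms b}` we have `b ⫝^CK_{Ms} c`. -/
def IsCanonicalGlobal (R : IndRel L 𝕄) (κ : Cardinal.{u}) (Ms : Set 𝕄) {α : Type v}
    (q : GlobalType L 𝕄 α) : Prop :=
  ∀ (β : Type u), Cardinal.mk β < κ → ∀ (b : β → 𝕄) (c : α → 𝕄),
    RealizesType q c (Ms ∪ Set.range b) → R.rel (Set.range b) Ms (Set.range c)

/-- A canonical Morley sequence over `Ms`: a coheir Morley sequence in a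
canonical coheir. -/
def CanonicalMorley (R : IndRel L 𝕄) (κ : Cardinal.{u}) (Ms : Set 𝕄) {α : Type v}
    (I : ℕ → α → 𝕄) : Prop :=
  ∃ q : GlobalType L 𝕄 α, IsCanonicalGlobal R κ Ms q ∧ MorleyIn q Ms I

/-- `q` is a strong canonical global type over `Ms`. -/
def IsStrongCanonical (R : IndRel L 𝕄) (κ : Cardinal.{u}) (Ms : Set 𝕄) {α : Type v}
    (q : GlobalType L 𝕄 α) : Prop :=
  ∀ (β : Type u), Cardinal.mk β < κ → ∀ (b : β → 𝕄) (c : α → 𝕄),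
    RealizesType q c (Ms ∪ Set.range b) →
    ∀ (γ : Type u), Cardinal.mk γ < κ → ∀ (a : γ → 𝕄),
      ∃ a' : γ → 𝕄, EqTpOver L (Ms ∪ Set.range c) a' a ∧
        ∃ q' : GlobalType L 𝕄 (γ ⊕ α), IsCanonicalGlobal R κ Ms q' ∧
          ExtendsTpOver q' (Ms ∪ Set.range b) (Sum.elim a' c)

/-! ### `M`-invariant ideals and `𝓘`-Kim-dividing -/

/-- An `Ms`-invariant ideal on the definable subsets of `𝕄` (in variables `α`). -/
structure InvIdeal (L : FirstOrder.Language.{u, u}) (𝕄 : Type u) [L.Structure 𝕄] (Ms : Set 𝕄)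
    (α : Type v) where
  mem : Set (α → 𝕄) → Prop
  definable_of_mem : ∀ S, mem S → ∃ (n : ℕ) (ψ : L.Formula (α ⊕ Fin n)) (c : Fin n → 𝕄),
    S = {a : α → 𝕄 | ψ.Realize (Sum.elim a c)}
  union_mem : ∀ S T, mem S → mem T → mem (S ∪ T)
  subset_mem : ∀ S T, mem S →
    (∃ (n : ℕ) (ψ : L.Formula (α ⊕ Fin n)) (c : Fin n → 𝕄),
      T = {a : α → 𝕄 | ψ.Realize (Sum.elim a c)}) →
    T ⊆ S → mem T
  invariant : ∀ σ : 𝕄 ≃[L] 𝕄, (∀ x ∈ Ms, σ x = x) → ∀ S, mem S →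
    mem ((fun a => (⇑σ) ∘ a) '' S)

/-- `φ(x, b)` `𝓘`-Kim-divides over `Ms`. -/
def IKimDivides {Ms : Set 𝕄} {α : Type v} (I : InvIdeal L 𝕄 Ms α) {n : ℕ}
    (φ : L.Formula (α ⊕ Fin n)) (b : Fin n → 𝕄) : Prop :=
  ∃ (B : ℕ → Fin n → 𝕄) (k : ℕ), CoheirMorley L Ms B ∧ B 0 = b ∧ 0 < k ∧
    ∀ s : Finset ℕ, s.card = k →
      I.mem {a : α → 𝕄 | ∀ i ∈ s, φ.Realize (Sum.elim a (B i))}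

/-- `φ(x, b)` `𝓘`-Kim-forks over `Ms`. -/
def IKimForks {Ms : Set 𝕄} {α : Type v} (I : InvIdeal L 𝕄 Ms α) {n : ℕ}
    (φ : L.Formula (α ⊕ Fin n)) (b : Fin n → 𝕄) : Prop :=
  ∃ (N : ℕ) (m : Fin N → ℕ) (ψ : ∀ j : Fin N, L.Formula (α ⊕ Fin (m j)))
    (c : ∀ j : Fin N, Fin (m j) → 𝕄),
    (∀ j, IKimDivides I (ψ j) (c j)) ∧
    ∀ a : α → 𝕄, φ.Realize (Sum.elim a b) → ∃ j, (ψ j).Realize (Sum.elim a (c j))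

/-- `φ(x, b)` `𝓘`-quasi-divides over `Ms`. -/
def IQuasiDivides {Ms : Set 𝕄} {α : Type v} (I : InvIdeal L 𝕄 Ms α) {n : ℕ}
    (φ : L.Formula (α ⊕ Fin n)) (b : Fin n → 𝕄) : Prop :=
  ∃ (mm : ℕ) (b' : Fin mm → Fin n → 𝕄), 0 < mm ∧ (∀ j, EqTpOver L Ms (b' j) b) ∧
    I.mem {a : α → 𝕄 | ∀ j, φ.Realize (Sum.elim a (b' j))}

/-! ### `h^⫝`-inconsistency and the derived relation `⫝'` -/

/-- A family of formulas is `h^⫝`-inconsistent with respect to `P = tp(a₀/Ms)`. -/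
def HInconsistent (R : IndRel L 𝕄) (Ms : Set 𝕄) {α : Type v} (a₀ : α → 𝕄)
    {ι : Type w} (m : ι → ℕ) (φ : ∀ i : ι, L.Formula (α ⊕ Fin (m i)))
    (b : ∀ i : ι, Fin (m i) → 𝕄) : Prop :=
  ¬ ∃ a : α → 𝕄, EqTpOver L Ms a a₀ ∧
      R.rel (Set.range a) Ms (⋃ i, Set.range (b i)) ∧
      ∀ i, (φ i).Realize (Sum.elim a (b i))

/-- A single formula is `h^⫝`-inconsistent with respect to `P = tp(a₀/Ms)`. -/
def HInconsistentSingle (R : IndRel L 𝕄) (Ms : Set 𝕄) {α : Type v} (a₀ : α → 𝕄)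
    {n : ℕ} (φ : L.Formula (α ⊕ Fin n)) (b : Fin n → 𝕄) : Prop :=
  ¬ ∃ a : α → 𝕄, EqTpOver L Ms a a₀ ∧ R.rel (Set.range a) Ms (Set.range b) ∧
      φ.Realize (Sum.elim a b)

/-- `φ(x, b)` `h^⫝`-Kim-divides with respect to `tp(a₀/Ms)`. -/
def HKimDivides (R : IndRel L 𝕄) (Ms : Set 𝕄) {α : Type v} (a₀ : α → 𝕄)
    {n : ℕ} (φ : L.Formula (α ⊕ Fin n)) (b : Fin n → 𝕄) : Prop :=
  ∃ B : ℕ → Fin n → 𝕄, CoheirMorley L Ms B ∧ B 0 = b ∧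
    HInconsistent R Ms a₀ (fun _ : ℕ => n) (fun _ => φ) B

/-- `φ(x, b)` `h^⫝`-Kim-forks with respect to `tp(a₀/Ms)`. -/
def HKimForks (R : IndRel L 𝕄) (Ms : Set 𝕄) {α : Type v} (a₀ : α → 𝕄)
    {n : ℕ} (φ : L.Formula (α ⊕ Fin n)) (b : Fin n → 𝕄) : Prop :=
  ∃ (N : ℕ) (m : Fin N → ℕ) (ψ : ∀ j : Fin N, L.Formula (α ⊕ Fin (m j)))
    (c : ∀ j : Fin N, Fin (m j) → 𝕄),
    (∀ j, HKimDivides R Ms a₀ (ψ j) (c j)) ∧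
    ∀ a : α → 𝕄, φ.Realize (Sum.elim a b) → ∃ j, (ψ j).Realize (Sum.elim a (c j))

/-- `φ(x, b)` `h^⫝`-quasi-divides with respect to `tp(a₀/Ms)`. -/
def HQuasiDivides (R : IndRel L 𝕄) (Ms : Set 𝕄) {α : Type v} (a₀ : α → 𝕄)
    {n : ℕ} (φ : L.Formula (α ⊕ Fin n)) (b : Fin n → 𝕄) : Prop :=
  ∃ (mm : ℕ) (b' : Fin mm → Fin n → 𝕄), 0 < mm ∧ (∀ j, EqTpOver L Ms (b' j) b) ∧
    HInconsistent R Ms a₀ (fun _ : Fin mm => n) (fun _ => φ) b'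

/-- The derived relation `⫝'` on tuples:
`tp(a / Ms b)` contains no formula `h^⫝`-Kim-forking w.r.t. `tp(a/Ms)`. -/
def DerivedIndep (R : IndRel L 𝕄) (Ms : Set 𝕄) {α : Type v} {β : Type w}
    (a : α → 𝕄) (b : β → 𝕄) : Prop :=
  ∀ (n : ℕ) (φ : L.Formula (α ⊕ Fin n)) (d : Fin n → 𝕄),
    (∀ i, d i ∈ Ms ∪ Set.range b) → φ.Realize (Sum.elim a d) →
    ¬ HKimForks R Ms a φ d

/-- The derived relation `⫝'` as a relation between sets over models. -/
def derived (R : IndRel L 𝕄) : IndRel L 𝕄 where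
  rel A Ms B := ∀ (n : ℕ) (φ : L.Formula (↥A ⊕ Fin n)) (d : Fin n → 𝕄),
    (∀ i, d i ∈ Ms ∪ B) → φ.Realize (Sum.elim (fun x : A => (x : 𝕄)) d) →
    ¬ HKimForks R Ms (fun x : A => (x : 𝕄)) φ d

/-! ### Coheir trees -/

/-- The tuple, indexed by extensions, consisting of the part of the tree `c`
lying (weakly) above the node `ν` (where `ν` has length `Lh`). -/
def subtreeTupleLen {α : Type v} {n : ℕ} (c : {l : List ℕ // l.length ≤ n} → α → 𝕄)
    (Lh : ℕ) (ν : List ℕ) (hν : ν.length = Lh) :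
    ({s : List ℕ // Lh + s.length ≤ n} × α) → 𝕄 :=
  fun p => c ⟨ν ++ p.1.1, by rw [List.length_append, hν]; exact p.1.2⟩ p.2

end NSOP2Paper

namespace NSOP2Paper

/-! ### Combinatorics of the binary tree -/

/-- `Tall 𝓕 h v F`: above `v` there is a perfectly branching tree of height `h`
each of whose branches, together with `F`, belongs to `𝓕`. -/
def Tall (𝓕 : Set (List Bool) → Prop) : ℕ → List Bool → Set (List Bool) → Prop
  | 0, _, F => 𝓕 F
  | h + 1, v, F => ∃ w z, v <+: w ∧ w <+: z ∧
      Tall 𝓕 h (z ++ [false]) (insert w F) ∧ Tall 𝓕 h (z ++ [true]) (insert w F)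

theorem Tall.anti_node {𝓕 : Set (List Bool) → Prop} {h : ℕ} {v v' : List Bool}
    {F : Set (List Bool)} (hv : v <+: v') (H : Tall 𝓕 h v' F) : Tall 𝓕 h v F := by
  cases h with
  | zero => exact H
  | succ h =>
    obtain ⟨w, z, hw, hz, H⟩ := H
    exact ⟨w, z, hv.trans hw, hz, H⟩

theorem Tall.anti_height {𝓕 : Set (List Bool) → Prop}
    (h𝓕 : ∀ F F', F ⊆ F' → 𝓕 F' → 𝓕 F) {h : ℕ} {v : List Bool}
    {F : Set (List Bool)} (H : Tall 𝓕 (h + 1) v F) : Tall 𝓕 h v F := by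
  induction h generalizing v F with
  | zero =>
    obtain ⟨w, z, -, -, H0, -⟩ := H
    exact h𝓕 _ _ (Set.subset_insert _ _) H0
  | succ h ih =>
    obtain ⟨w, z, hw, hz, H0, H1⟩ := H
    exact ⟨w, z, hw, hz, ih H0, ih H1⟩

theorem Tall.exists_tree {𝓕 : Set (List Bool) → Prop}
    (h𝓕 : ∀ F F', F ⊆ F' → 𝓕 F' → 𝓕 F) {h : ℕ} {v : List Bool}
    {F : Set (List Bool)} (H : Tall 𝓕 h v F) :
    ∃ f z : List Bool → List Bool, (∀ η : List Bool, η.length < h → v <+: f η) ∧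
      (∀ u c σ, (u ++ c :: σ).length < h → z u ++ [c] <+: f (u ++ c :: σ)) ∧
      ∀ η : List Bool, η.length < h → 𝓕 (F ∪ {y | ∃ x, x <+: η ∧ y = f x}) := by
  induction h generalizing v F with
  | zero => exact ⟨id, id, by simp, by simp, by simp⟩
  | succ h ih =>
    obtain ⟨w, z, hw, hz, H0, H1⟩ := H
    have hroot : 𝓕 (insert w F) := by
      have : ∀ h' v', Tall 𝓕 h' v' (insert w F) → 𝓕 (insert w F) := by
        intro h'
        induction h' with
        | zero => exact fun _ H => H
        | succ h' ih' => exact fun v' H => ih' v' (H.anti_height h𝓕)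
      exact this _ _ H0
    have H : ∀ c : Bool, Tall 𝓕 h (z ++ [c]) (insert w F) := by
      rintro (_ | _)
      exacts [H0, H1]
    choose f z' h1 h2 h3 using fun c => ih (H c)
    refine ⟨fun l => l.casesOn w (fun c η => f c η), fun l => l.casesOn z (fun c η => z' c η),
      ?_, ?_, ?_⟩
    · rintro (_ | ⟨c, η⟩) hη
      · exact hw
      · exact hw.trans (hz.trans ((List.prefix_append z [c]).trans
          (h1 c η (by simpa using hη))))
    · rintro (_ | ⟨d, u⟩) c σ hη
      · exact h1 c σ (by simpa using hη)
      · exact h2 d u c σ (by simpa using hη)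
    · rintro (_ | ⟨c, η⟩) hη
      · refine h𝓕 _ _ ?_ hroot
        rintro y (hy | ⟨x, hx, rfl⟩)
        · exact Or.inr hy
        · obtain rfl : x = [] := by simpa using hx
          exact Or.inl rfl
      · refine h𝓕 _ _ ?_ (h3 c η (by simpa using hη))
        rintro y (hy | ⟨x, hx, rfl⟩)
        · exact Or.inl (Or.inr hy)
        · rcases x with _ | ⟨d, x⟩
          · exact Or.inl (Or.inl rfl)
          · obtain ⟨rfl, hxη⟩ := List.cons_prefix_cons.1 hx
            exact Or.inr ⟨x, hxη, rfl⟩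

/-- A map of the binary tree sending the two cones above a node into the two cones
above some node. -/
def TreeEmb (f : List Bool → List Bool) : Prop :=
  ∃ z : List Bool → List Bool, ∀ η, f η <+: z η ∧ ∀ c, z η ++ [c] <+: f (η ++ [c])

theorem TreeEmb.mono {f : List Bool → List Bool} (hf : TreeEmb f) {x y : List Bool}
    (h : x <+: y) : f x <+: f y := by
  obtain ⟨z, hz⟩ := hf
  obtain ⟨t, rfl⟩ := h
  induction t using List.reverseRecOn with
  | nil => simp
  | append_singleton t c ih =>
    rw [← List.append_assoc]
    exact ih.trans ((hz _).1.trans ((List.prefix_append _ _).trans ((hz _).2 c)))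

theorem TreeEmb.exists_branch {f : List Bool → List Bool} (hf : TreeEmb f) (η : List Bool) :
    ∃ z, f η <+: z ∧ ∀ c y, η ++ [c] <+: y → z ++ [c] <+: f y := by
  obtain ⟨z, hz⟩ := id hf
  exact ⟨z η, (hz η).1, fun c y hy => ((hz η).2 c).trans (hf.mono hy)⟩

theorem TreeEmb.comp {f g : List Bool → List Bool} (hf : TreeEmb f) (hg : TreeEmb g) :
    TreeEmb (f ∘ g) := by
  have : ∀ η, ∃ z, f (g η) <+: z ∧ ∀ c, z ++ [c] <+: f (g (η ++ [c])) := by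
    intro η
    obtain ⟨y, hy, hy'⟩ := hg.exists_branch η
    obtain ⟨z, hz, hz'⟩ := hf.exists_branch y
    exact ⟨z, (hf.mono hy).trans hz, fun c => hz' c _ (hy' c _ List.prefix_rfl)⟩
  choose z hz using this
  exact ⟨z, hz⟩

theorem treeEmb_id : TreeEmb id := ⟨id, fun _ => ⟨List.prefix_rfl, fun _ => List.prefix_rfl⟩⟩

theorem treeEmb_append (u : List Bool) : TreeEmb (u ++ ·) :=
  ⟨(u ++ ·), fun η => ⟨List.prefix_rfl, fun c => by simp⟩⟩

/-- `F 0, …, F (h - 1)` is strictly increasing for the prefix order. -/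
def StrictChain (h : ℕ) (F : ℕ → List Bool) : Prop :=
  ∀ i j, i < j → j < h → ∃ c, F i ++ [c] <+: F j

theorem StrictChain.map {f : List Bool → List Bool} (hf : TreeEmb f) {h : ℕ}
    {F : ℕ → List Bool} (hF : StrictChain h F) : StrictChain h (fun i => f (F i)) := by
  intro i j hij hj
  obtain ⟨c, hc⟩ := hF i j hij hj
  obtain ⟨z, hz, hz'⟩ := hf.exists_branch (F i)
  obtain ⟨t, rfl⟩ := hz
  have := hz' c _ hc
  rcases t with _ | ⟨d, t⟩
  · exact ⟨c, by simpa using this⟩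
  · exact ⟨d, List.IsPrefix.trans (by simp) this⟩

theorem StrictChain.injOn {h : ℕ} {F : ℕ → List Bool} (hF : StrictChain h F) :
    Set.InjOn F (Set.Iio h) := by
  have key : ∀ i j, i < j → j < h → F i ≠ F j := by
    intro i j hij hj he
    obtain ⟨c, hc⟩ := hF i j hij hj
    have := hc.length_le
    simp [he] at this
  intro i hi j hj he
  rcases lt_trichotomy i j with h1 | h1 | h1
  · exact absurd he (key i j h1 hj)
  · exact h1
  · exact absurd he.symm (key j i h1 hi)

theorem Tall.of_treeEmb {f : List Bool → List Bool} (hf : TreeEmb f)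
    {𝓕 : Set (List Bool) → Prop} {h : ℕ} {v : List Bool} {F : Set (List Bool)}
    (H : Tall (fun G => 𝓕 (f '' G)) h v F) : Tall 𝓕 h (f v) (f '' F) := by
  induction h generalizing v F with
  | zero => exact H
  | succ h ih =>
    obtain ⟨w, z, hw, hz, H0, H1⟩ := H
    obtain ⟨y, hy, hy'⟩ := hf.exists_branch z
    have H0 := ih H0
    have H1 := ih H1
    rw [Set.image_insert_eq] at H0 H1
    exact ⟨f w, y, hf.mono hw, (hf.mono hz).trans hy, H0.anti_node (hy' _ _ List.prefix_rfl),
      H1.anti_node (hy' _ _ List.prefix_rfl)⟩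

theorem exists_deciding (𝓕 : Set (List Bool) → Prop) {S : Set (Set (List Bool) × ℕ)}
    (hS : S.Finite) (v : List Bool) :
    ∃ z, v <+: z ∧ ∀ p ∈ S, Tall 𝓕 p.2 z p.1 → ∀ z', z <+: z' → Tall 𝓕 p.2 z' p.1 := by
  induction S, hS using Set.Finite.induction_on with
  | empty => exact ⟨v, List.prefix_rfl, by simp⟩
  | @insert p S _ _ ih =>
    obtain ⟨z, hz, hd⟩ := ih
    by_cases h : ∀ z', z <+: z' → Tall 𝓕 p.2 z' p.1
    · refine ⟨z, hz, ?_⟩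
      rintro p' (rfl | hp') H
      · exact h
      · exact hd _ hp' H
    · push Not at h
      obtain ⟨z', hz', hn⟩ := h
      refine ⟨z', hz.trans hz', ?_⟩
      rintro p' (rfl | hp') H
      · exact absurd H hn
      · exact fun y hy => hd _ hp' (H.anti_node hz') y (hz'.trans hy)

theorem exists_thin {𝓕 : Set (List Bool) → Prop} {h : ℕ} (H : ¬ Tall 𝓕 h [] ∅) :
    ∃ g, TreeEmb g ∧ ∀ F, StrictChain h F → ¬ 𝓕 ((fun i => g (F i)) '' Set.Iio h) := by
  have hZ : ∀ s : Set (List Bool) × List Bool, ∃ z, s.2 <+: z ∧ (s.1.Finite →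
      ∀ F ⊆ insert s.2 s.1, ∀ h' ≤ h, Tall 𝓕 h' z F → ∀ z', z <+: z' → Tall 𝓕 h' z' F) := by
    rintro ⟨P, v⟩
    by_cases hP : P.Finite
    · obtain ⟨z, hz, hd⟩ := exists_deciding 𝓕
        (S := {F | F ⊆ insert v P} ×ˢ Set.Iic h)
        ((hP.insert v).finite_subsets.prod (Set.finite_Iic h)) v
      exact ⟨z, hz, fun _ F hF h' hh' => hd (F, h') ⟨hF, hh'⟩⟩
    · exact ⟨v, List.prefix_rfl, fun h => absurd h hP⟩
  choose Z hZ1 hZ2 using hZ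
  let step : Set (List Bool) × List Bool → Bool → Set (List Bool) × List Bool :=
    fun s c => (insert s.2 s.1, Z s ++ [c])
  let st : List Bool → Set (List Bool) × List Bool := fun η => η.foldl step (∅, [])
  have hst : ∀ η c, st (η ++ [c]) = step (st η) c := fun η c => by simp [st]
  have hfin : ∀ η, (st η).1.Finite := by
    intro η
    induction η using List.reverseRecOn with
    | nil => exact Set.finite_empty
    | append_singleton η c ih => rw [hst]; exact ih.insert _
  have hg : TreeEmb (fun η => (st η).2) :=
    ⟨fun η => Z (st η), fun η => ⟨hZ1 _, fun c => by simp only [hst]; exact List.prefix_rfl⟩⟩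
  have hpast : ∀ η t c, (st η).2 ∈ (st (η ++ t ++ [c])).1 := by
    intro η t
    induction t using List.reverseRecOn with
    | nil => intro c; rw [List.append_nil, hst]; exact Or.inl rfl
    | append_singleton t d ih =>
      intro c
      rw [hst, ← List.append_assoc]
      exact Or.inr (ih d)
  have hinv : ∀ η, ∀ F ⊆ (st η).1, F.ncard ≤ h → ¬ Tall 𝓕 (h - F.ncard) (st η).2 F := by
    intro η
    induction η using List.reverseRecOn with
    | nil =>
      intro F hF _
      obtain rfl : F = ∅ := Set.subset_empty_iff.1 hF
      simpa [st] using H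
    | append_singleton η c ih =>
      intro F hF hcard hT
      rw [hst] at hF hT
      have hT' : Tall 𝓕 (h - F.ncard) (Z (st η)) F := hT.anti_node (List.prefix_append _ _)
      by_cases hv : F ⊆ (st η).1
      · exact ih F hv hcard (hT'.anti_node (hZ1 _))
      · have hvF : (st η).2 ∈ F := by
          obtain ⟨x, hx, hx'⟩ := Set.not_subset.1 hv
          rcases hF hx with rfl | h
          exacts [hx, absurd h hx']
        have hsub : F \ {(st η).2} ⊆ (st η).1 := by
          rintro x ⟨hx, hne⟩
          exact (hF hx).resolve_left hne
        have hc := Set.ncard_sdiff_singleton_add_one hvF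
          (((hfin η).insert _).subset hF)
        have hall := hZ2 (st η) (hfin η) F hF _ (Nat.sub_le _ _) hT'
        refine ih _ hsub (by omega) ?_
        have : h - (F \ {(st η).2}).ncard = h - F.ncard + 1 := by omega
        rw [this]
        refine ⟨(st η).2, Z (st η), List.prefix_rfl, hZ1 _, ?_, ?_⟩ <;>
        · rw [Set.insert_sdiff_singleton, Set.insert_eq_of_mem hvF]
          exact hall _ (List.prefix_append _ _)
  refine ⟨_, hg, fun F hF h𝓕 => ?_⟩
  have hcard : ((fun i => (st (F i)).2) '' Set.Iio h).ncard = h := by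
    rw [Set.InjOn.ncard_image (hF.map hg).injOn, Set.ncard_eq_toFinset_card']
    simp
  have := hinv (F (h - 1) ++ [true]) ((fun i => (st (F i)).2) '' Set.Iio h) ?_ hcard.le
  · rw [hcard, Nat.sub_self] at this
    exact this h𝓕
  · rintro _ ⟨i, hi, rfl⟩
    have hi' : i < h := hi
    obtain ⟨t, ht⟩ : F i <+: F (h - 1) := by
      rcases Nat.lt_or_ge i (h - 1) with h1 | h1
      · obtain ⟨c, hc⟩ := hF i (h - 1) h1 (by omega)
        exact (List.prefix_append _ _).trans hc
      · rw [show h - 1 = i by omega]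
    rw [← ht]
    exact hpast _ _ _

theorem exists_thin_many {X : Type*} {P : X → List Bool → Prop} {h : ℕ}
    (H : ∀ a u, u ++ [true] <+: a →
      ¬ Tall (fun F => ∃ x, P x a ∧ ∀ y ∈ F, P x y) h (u ++ [false]) ∅)
    {A : Set (List Bool)} (hA : A.Finite) {f : List Bool → List Bool} (hf : TreeEmb f)
    (hAf : ∀ a ∈ A, ∃ u, u ++ [true] <+: a ∧ u ++ [false] <+: f []) :
    ∃ g, TreeEmb g ∧ ∀ a ∈ A, ∀ F, StrictChain h F →
      ¬ ∃ x, P x a ∧ ∀ i < h, P x (f (g (F i))) := by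
  induction A, hA using Set.Finite.induction_on with
  | empty => exact ⟨id, treeEmb_id, by simp⟩
  | @insert a A _ _ ih =>
    obtain ⟨g, hg, hgA⟩ := ih fun a ha => hAf a (Or.inr ha)
    have hfg := hf.comp hg
    obtain ⟨u, hu, hu'⟩ := hAf a (Or.inl rfl)
    obtain ⟨g', hg', hgg⟩ := exists_thin
      (𝓕 := fun G => ∃ x, P x a ∧ ∀ y ∈ (f ∘ g) '' G, P x y) (h := h) (fun hT => by
        have := Tall.of_treeEmb hfg (𝓕 := fun F => ∃ x, P x a ∧ ∀ y ∈ F, P x y) hT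
        rw [Set.image_empty] at this
        exact H a u hu (this.anti_node (hu'.trans (hf.mono List.nil_prefix))))
    refine ⟨g ∘ g', hg.comp hg', ?_⟩
    rintro a' (rfl | ha') F hF ⟨x, hx, hx'⟩
    · refine hgg F hF ⟨x, hx, ?_⟩
      rintro _ ⟨_, ⟨i, hi, rfl⟩, rfl⟩
      exact hx' i hi
    · exact hgA a' ha' _ (hF.map hg') ⟨x, hx, hx'⟩

theorem exists_block_tree {X : Type*} {P : X → List Bool → Prop} {h : ℕ} (hpos : 0 < h)
    (H : ∀ a u, u ++ [true] <+: a →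
      ¬ Tall (fun F => ∃ x, P x a ∧ ∀ y ∈ F, P x y) h (u ++ [false]) ∅)
    (n : ℕ) {f : List Bool → List Bool} (hf : TreeEmb f) :
    ∃ F : List Bool → ℕ → List Bool,
      (∀ η : List Bool, η.length < n → StrictChain h (F η)) ∧
      (∀ η : List Bool, η.length < n → ∃ w, ∀ x, x <+: η → ∀ i < h, F x i <+: w) ∧
      (∀ η η' : List Bool, η.length < n → η'.length < n → ¬ η <+: η' → ¬ η' <+: η →
        ¬ ∃ x, ∀ i < h, P x (f (F η i)) ∧ P x (f (F η' i))) := by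
  induction n generalizing f with
  | zero => exact ⟨fun _ _ => [], by simp, by simp, by simp⟩
  | succ n ih =>
    let o : ℕ → List Bool := fun i => List.replicate i false
    have hf1 := hf.comp (treeEmb_append (o h ++ [true]))
    have hf0 := hf.comp (treeEmb_append (o h ++ [false]))
    obtain ⟨F1, c1, w1, i1⟩ := ih hf1
    obtain ⟨z, -, hz⟩ := hf.exists_branch (o h)
    obtain ⟨g, hg, hgA⟩ := exists_thin_many H
      (A := (fun η => f (o h ++ [true] ++ F1 η 0)) '' {η | η.length < n})
      ((List.finite_length_lt Bool n).image _) hf0 (by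
        rintro _ ⟨η, -, rfl⟩
        exact ⟨z, hz _ _ (by simp), hz _ _ (by simp)⟩)
    obtain ⟨F0, c0, w0, i0⟩ := ih (hf0.comp hg)
    have hcross : ∀ η η' : List Bool, η.length < n → η'.length < n →
        ¬ ∃ x, ∀ i < h, P x (f (o h ++ [false] ++ g (F0 η i))) ∧
          P x (f (o h ++ [true] ++ F1 η' i)) := by
      rintro η η' hη hη' ⟨x, hx⟩
      exact hgA _ ⟨η', hη', rfl⟩ (F0 η) (c0 η hη) ⟨x, (hx 0 hpos).2, fun i hi => (hx i hi).1⟩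
    refine ⟨fun η i => match η with
      | [] => o i
      | false :: η => o h ++ [false] ++ g (F0 η i)
      | true :: η => o h ++ [true] ++ F1 η i, ?_, ?_, ?_⟩
    · rintro (_ | ⟨_ | _, η⟩) hη
      · intro i j hij hj
        refine ⟨false, List.replicate (j - i - 1) false, ?_⟩
        simp only [o, ← List.replicate_succ', List.replicate_append_replicate]
        congr 1
        omega
      · exact ((c0 η (by simpa using hη)).map hg).map (treeEmb_append _)
      · exact (c1 η (by simpa using hη)).map (treeEmb_append _)
    · have ho : ∀ i < h, o i <+: o h := fun i hi => by
        refine ⟨List.replicate (h - i) false, ?_⟩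
        simp only [o, List.replicate_append_replicate]
        congr 1
        omega
      rintro (_ | ⟨_ | _, η⟩) hη
      · refine ⟨o h, fun x hx i hi => ?_⟩
        obtain rfl : x = [] := by simpa using hx
        exact ho i hi
      · obtain ⟨w, hw⟩ := w0 η (by simpa using hη)
        refine ⟨o h ++ [false] ++ g w, ?_⟩
        rintro (_ | ⟨d, x⟩) hx i hi
        · exact (ho i hi).trans (by simp)
        · obtain ⟨rfl, hxη⟩ := List.cons_prefix_cons.1 hx
          exact (List.prefix_append_right_inj _).2 (hg.mono (hw x hxη i hi))
      · obtain ⟨w, hw⟩ := w1 η (by simpa using hη)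
        refine ⟨o h ++ [true] ++ w, ?_⟩
        rintro (_ | ⟨d, x⟩) hx i hi
        · exact (ho i hi).trans (by simp)
        · obtain ⟨rfl, hxη⟩ := List.cons_prefix_cons.1 hx
          exact (List.prefix_append_right_inj _).2 (hw x hxη i hi)
    · rintro (_ | ⟨c, η⟩) (_ | ⟨d, η'⟩) hη hη' h1 h2
      · simp at h1
      · simp at h1
      · simp at h2
      · rcases c with _ | _ <;> rcases d with _ | _
        · exact i0 η η' (by simpa using hη) (by simpa using hη')
            (fun h => h1 (by simpa using h)) (fun h => h2 (by simpa using h))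
        · exact hcross η η' (by simpa using hη) (by simpa using hη')
        · rintro ⟨x, hx⟩
          exact hcross η' η (by simpa using hη') (by simpa using hη)
            ⟨x, fun i hi => (hx i hi).symm⟩
        · exact i1 η η' (by simpa using hη) (by simpa using hη')
            (fun h => h1 (by simpa using h)) (fun h => h2 (by simpa using h))

theorem comb_or_blocks {X : Type*} (P : X → List Bool → Prop) :
    (∀ h, ∃ (a u : List Bool) (f z : List Bool → List Bool), u ++ [true] <+: a ∧
      (∀ η : List Bool, η.length < h → u ++ [false] <+: f η) ∧
      (∀ u c σ, (u ++ c :: σ).length < h → z u ++ [c] <+: f (u ++ c :: σ)) ∧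
      ∀ η : List Bool, η.length < h → ∃ x, P x a ∧ ∀ y, y <+: η → P x (f y)) ∨
    ∃ h : ℕ, ∀ n, ∃ F : List Bool → ℕ → List Bool,
      (∀ η : List Bool, η.length < n → ∃ w, ∀ x, x <+: η → ∀ i < h, F x i <+: w) ∧
      (∀ η η' : List Bool, η.length < n → η'.length < n → ¬ η <+: η' → ¬ η' <+: η →
        ¬ ∃ x, ∀ i < h, P x (F η i) ∧ P x (F η' i)) := by
  have anti : ∀ a, ∀ F F' : Set (List Bool), F ⊆ F' → (∃ x, P x a ∧ ∀ y ∈ F', P x y) →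
      ∃ x, P x a ∧ ∀ y ∈ F, P x y :=
    fun a F F' hF ⟨x, hx, hx'⟩ => ⟨x, hx, fun y hy => hx' y (hF hy)⟩
  by_cases H : ∀ h, ∃ a u, u ++ [true] <+: a ∧
      Tall (fun F => ∃ x, P x a ∧ ∀ y ∈ F, P x y) h (u ++ [false]) ∅
  · left
    intro h
    obtain ⟨a, u, hu, hT⟩ := H h
    obtain ⟨f, z, h1, h2, h3⟩ := hT.exists_tree (anti a)
    refine ⟨a, u, f, z, hu, h1, h2, fun η hη => ?_⟩
    obtain ⟨x, hx, hx'⟩ := h3 η hη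
    exact ⟨x, hx, fun y hy => hx' _ (Or.inr ⟨y, hy, rfl⟩)⟩
  · right
    push Not at H
    obtain ⟨h, H⟩ := H
    refine ⟨h + 1, fun n => ?_⟩
    obtain ⟨F, -, h2, h3⟩ := exists_block_tree (P := P) (h := h + 1) h.succ_pos
      (fun a u hu hT => H a u hu (hT.anti_height (anti a))) n treeEmb_id
    exact ⟨F, h2, h3⟩

/-! ### Definable sets -/

section Definable

variable {L : FirstOrder.Language.{u, u}} {𝕄 : Type u} [L.Structure 𝕄]

theorem definable_subst {α : Type v} {β : Type w} {C : Set 𝕄} {S : Set (α → 𝕄)}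
    (hS : C.Definable L S) (τ : α → C ⊕ β) :
    C.Definable L {g : β → 𝕄 | (fun i => Sum.elim Subtype.val g (τ i)) ∈ S} := by
  obtain ⟨φ, rfl⟩ := Set.definable_iff_exists_formula_sum.1 hS
  refine Set.definable_iff_exists_formula_sum.2 ⟨φ.relabel (Sum.elim Sum.inl τ), ?_⟩
  ext g
  simp only [Set.mem_ofPred_eq, Formula.realize_relabel]
  refine iff_of_eq (congrArg _ ?_)
  funext i
  rcases i with i | i <;> rfl

theorem definable_iff_params {α : Type v} {C : Set 𝕄} {S : Set (α → 𝕄)} :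
    C.Definable L S ↔ ∃ (n : ℕ) (φ : L.Formula (α ⊕ Fin n)) (c : Fin n → 𝕄),
      (∀ i, c i ∈ C) ∧ S = {a | φ.Realize (Sum.elim a c)} := by
  constructor
  · intro hS
    obtain ⟨A, hA, hS⟩ := Set.definable_iff_finitely_definable.1 hS
    obtain ⟨φ, rfl⟩ := Set.definable_iff_exists_formula_sum.1 hS
    let e := A.equivFin
    refine ⟨A.card, φ.relabel (Sum.elim (fun i => Sum.inr (e i)) Sum.inl),
      fun i => (e.symm i : 𝕄), fun i => hA (e.symm i).2, ?_⟩
    ext g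
    simp only [Set.mem_ofPred_eq, Formula.realize_relabel]
    refine iff_of_eq (congrArg _ ?_)
    funext i
    rcases i with i | i
    · simp
    · rfl
  · rintro ⟨n, φ, c, hc, rfl⟩
    refine Set.definable_iff_exists_formula_sum.2
      ⟨φ.relabel (Sum.elim Sum.inr fun i => Sum.inl ⟨c i, hc i⟩), ?_⟩
    ext g
    simp only [Set.mem_ofPred_eq, Formula.realize_relabel]
    refine iff_of_eq (congrArg _ ?_)
    funext i
    rcases i with i | i <;> rfl

theorem definable_union_range {α : Type v} {β : Type w} {C : Set 𝕄} {f : β → 𝕄}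
    {S : Set (α → 𝕄)} : (C ∪ Set.range f).Definable L S ↔
      ∃ S' : Set (α ⊕ β → 𝕄), C.Definable L S' ∧ S = {y | Sum.elim y f ∈ S'} := by
  constructor
  · intro hS
    obtain ⟨φ, rfl⟩ := Set.definable_iff_exists_formula_sum.1 hS
    have hτ : ∀ x : ↥(C ∪ Set.range f), ∃ t : C ⊕ β, Sum.elim Subtype.val f t = x := by
      rintro ⟨x, hx | ⟨j, rfl⟩⟩
      · exact ⟨Sum.inl ⟨x, hx⟩, rfl⟩
      · exact ⟨Sum.inr j, rfl⟩
    choose τ hτ using hτ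
    refine ⟨_, Set.definable_iff_exists_formula_sum.2
      ⟨φ.relabel (Sum.elim (fun x => Sum.map id Sum.inr (τ x)) (Sum.inr ∘ Sum.inl)), rfl⟩, ?_⟩
    ext g
    simp only [Set.mem_ofPred_eq, Formula.realize_relabel]
    refine iff_of_eq (congrArg _ ?_)
    funext i
    rcases i with i | i
    · have := hτ i
      simp only [Sum.elim_inl, Function.comp_apply]
      rw [← this]
      rcases τ i with t | t <;> rfl
    · rfl
  · rintro ⟨S', hS', rfl⟩
    have h := definable_subst (β := α) (hS'.mono (Set.subset_union_left (t := Set.range f)))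
      (Sum.elim Sum.inr fun j => Sum.inl (⟨f j, Or.inr ⟨j, rfl⟩⟩ : ↥(C ∪ Set.range f)))
    refine (congrArg ((C ∪ Set.range f).Definable L) ?_).mp h
    ext g
    refine iff_of_eq (congrArg (· ∈ S') ?_)
    funext i
    rcases i with i | i <;> rfl

theorem definable_fiber {α : Type v} {β : Type w} {C : Set 𝕄} {S : Set (α ⊕ β → 𝕄)}
    (hS : C.Definable L S) {y : α → 𝕄} (hy : ∀ i, y i ∈ C) :
    C.Definable L {f | Sum.elim y f ∈ S} := by
  have h := definable_subst hS (Sum.map (fun i => (⟨y i, hy i⟩ : C)) id)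
  refine (congrArg (C.Definable L) ?_).mp h
  ext g
  refine iff_of_eq (congrArg (· ∈ S) ?_)
  funext i
  rcases i with i | i <;> rfl

theorem eqTpOver_iff {α : Type v} {C : Set 𝕄} {a b : α → 𝕄} :
    EqTpOver L C a b ↔ ∀ S, C.Definable L S → (a ∈ S ↔ b ∈ S) := by
  constructor
  · intro h S hS
    obtain ⟨n, φ, c, hc, rfl⟩ := definable_iff_params.1 hS
    exact h n φ c hc
  · intro h n φ c hc
    exact h _ (definable_iff_params.2 ⟨n, φ, c, hc, rfl⟩)

theorem finSatIn_iff {α : Type v} {Ms C : Set 𝕄} {a : α → 𝕄} :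
    FinSatIn L Ms a C ↔ ∀ S, C.Definable L S → a ∈ S → ∃ m ∈ S, ∀ i, m i ∈ Ms := by
  constructor
  · intro h S hS ha
    obtain ⟨n, φ, c, hc, rfl⟩ := definable_iff_params.1 hS
    obtain ⟨m, hm, hm'⟩ := h n φ c hc ha
    exact ⟨m, hm', hm⟩
  · intro h n φ c hc ha
    obtain ⟨m, hm, hm'⟩ := h _ (definable_iff_params.2 ⟨n, φ, c, hc, rfl⟩) ha
    exact ⟨m, hm', hm⟩

theorem EqTpOver.refl {α : Type v} {C : Set 𝕄} (a : α → 𝕄) : EqTpOver L C a a :=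
  fun _ _ _ _ => Iff.rfl

theorem EqTpOver.symm {α : Type v} {C : Set 𝕄} {a b : α → 𝕄} (h : EqTpOver L C a b) :
    EqTpOver L C b a :=
  fun n φ c hc => (h n φ c hc).symm

theorem EqTpOver.trans {α : Type v} {C : Set 𝕄} {a b c : α → 𝕄} (h : EqTpOver L C a b)
    (h' : EqTpOver L C b c) : EqTpOver L C a c :=
  fun n φ d hd => (h n φ d hd).trans (h' n φ d hd)

theorem EqTpOver.comp {α : Type v} {β : Type w} {C : Set 𝕄} {a b : α → 𝕄}
    (h : EqTpOver L C a b) (f : β → α) : EqTpOver L C (a ∘ f) (b ∘ f) :=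
  eqTpOver_iff.2 fun _ hS => eqTpOver_iff.1 h _ (hS.preimage_comp f)

theorem exists_mem_of_definable {Ms : Set 𝕄} (hMs : IsElemSubmodel L Ms) {α : Type v}
    {S : Set (α → 𝕄)} (hS : Ms.Definable L S) (hne : S.Nonempty) :
    ∃ m ∈ S, ∀ i, m i ∈ Ms := by
  classical
  obtain ⟨E, rfl⟩ := hMs
  obtain ⟨a, ha⟩ := hne
  obtain ⟨φ, rfl⟩ := Set.definable_iff_exists_formula_sum.1 hS
  rcases isEmpty_or_nonempty α with hα | ⟨⟨i0⟩⟩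
  · exact ⟨a, ha, fun i => hα.elim i⟩
  have : Nonempty 𝕄 := ⟨a i0⟩
  obtain ⟨d⟩ : Nonempty E := inferInstance
  let f : φ.freeVarFinset → E ⊕ φ.freeVarFinset :=
    fun x => Sum.elim Sum.inl (fun _ => Sum.inr x) x.1
  let φ' : L.Formula (E ⊕ φ.freeVarFinset) := φ.restrictFreeVar f
  have h1 : (φ'.iExs φ.freeVarFinset).Realize (fun x : E => (x : 𝕄)) := by
    rw [Formula.realize_iExs]
    refine ⟨fun x => Sum.elim (fun y : E => (y : 𝕄)) a x.1, ?_⟩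
    refine (BoundedFormula.realize_restrictFreeVar (Sum.elim (fun y : E => (y : 𝕄)) a) ?_).2 ha
    rintro ⟨x | x, hx⟩ <;> rfl
  have h2 := (E.subtype.map_formula (φ'.iExs φ.freeVarFinset) id).1 h1
  rw [Formula.realize_iExs] at h2
  obtain ⟨y, hy⟩ := h2
  have h3 := (E.subtype.map_formula φ' _).2 hy
  refine ⟨fun i => if h : Sum.inr i ∈ φ.freeVarFinset then (y ⟨_, h⟩ : 𝕄) else d, ?_, ?_⟩
  · refine (BoundedFormula.realize_restrictFreeVar (f := f) _ ?_).1 h3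
    rintro ⟨x | x, hx⟩
    · rfl
    · simp [f, hx]
  · intro i
    dsimp only
    split_ifs
    exacts [Subtype.coe_prop _, d.2]

theorem exists_finite_support {α : Type v} {C : Set 𝕄} {S : Set (α → 𝕄)}
    (hS : C.Definable L S) (t : Finset α) :
    ∃ (s : Finset α) (S' : Set (s → 𝕄)), t ⊆ s ∧ C.Definable L S' ∧
      S = {g | (fun i : s => g i) ∈ S'} := by
  classical
  obtain ⟨φ, rfl⟩ := hS
  let ψ : L[[C]].Formula ↥(t ∪ φ.freeVarFinset) :=
    φ.restrictFreeVar (Set.inclusion (by simp))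
  refine ⟨t ∪ φ.freeVarFinset, _, Finset.subset_union_left, ⟨ψ, rfl⟩, ?_⟩
  ext g
  exact (BoundedFormula.realize_restrictFreeVar (f := Set.inclusion (by simp)) g
    (fun _ => rfl)).symm

theorem definable_image {α : Type v} {β : Type w} [Finite β] {C : Set 𝕄} {S : Set (α → 𝕄)}
    (hS : C.Definable L S) (ρ : β → α) : C.Definable L ((fun g => g ∘ ρ) '' S) := by
  classical
  rcases S.eq_empty_or_nonempty with rfl | ⟨g0, hg0⟩
  · simp
  cases nonempty_fintype β
  obtain ⟨s, S', ht, hS', rfl⟩ := exists_finite_support hS (Finset.univ.image ρ)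
  have hρ : ∀ j, ρ j ∈ s := fun j => ht (Finset.mem_image_of_mem _ (Finset.mem_univ j))
  convert hS'.image_comp (fun j => (⟨ρ j, hρ j⟩ : s)) using 1
  ext y
  constructor
  · rintro ⟨g, hg, rfl⟩
    exact ⟨_, hg, rfl⟩
  · rintro ⟨g, hg, rfl⟩
    refine ⟨fun i => if h : i ∈ s then g ⟨i, h⟩ else g0 i, ?_, ?_⟩
    · simpa using hg
    · funext j
      simp [hρ j]

theorem definable_finite_biInter {α : Type v} {C : Set 𝕄} {t : Set (Set (α → 𝕄))} (ht : t.Finite)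
    (h : ∀ S ∈ t, C.Definable L S) : C.Definable L (⋂₀ t) := by
  induction t, ht using Set.Finite.induction_on with
  | empty => simp
  | insert _ _ ih =>
    rw [Set.sInter_insert]
    exact (h _ (Or.inl rfl)).inter (ih fun S hS => h S (Or.inr hS))

theorem definable_aut {α : Type v} {C : Set 𝕄} {S : Set (α → 𝕄)}
    (hS : C.Definable L S) (σ : 𝕄 ≃[L] 𝕄) (hσ : ∀ x ∈ C, σ x = x) (a : α → 𝕄) :
    (fun i => σ (a i)) ∈ S ↔ a ∈ S := by
  obtain ⟨n, φ, c, hc, rfl⟩ := definable_iff_params.1 hS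
  refine Iff.trans (iff_of_eq (congrArg φ.Realize ?_))
    (StrongHomClass.realize_formula σ φ (v := Sum.elim a c))
  funext i
  rcases i with i | i
  · rfl
  · exact (hσ _ (hc i)).symm

theorem saturation {κ : Cardinal.{u}} (hsat : IsSaturated L 𝕄 κ) {α : Type u} {C : Set 𝕄}
    (hα : Cardinal.mk α < κ) (hC : Cardinal.mk C < κ) (𝒢 : Set (Set (α → 𝕄)))
    (hdef : ∀ S ∈ 𝒢, C.Definable L S)
    (hfin : ∀ t ⊆ 𝒢, t.Finite → (⋂₀ t).Nonempty) : (⋂₀ 𝒢).Nonempty := by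
  let sol : FmlP L 𝕄 α → Set (α → 𝕄) := fun p => {a | p.2.1.Realize (Sum.elim a p.2.2)}
  obtain ⟨a, ha⟩ := hsat α C hα hC {p | (∀ i, p.2.2 i ∈ C) ∧ sol p ∈ 𝒢} (fun p hp => hp.1) (by
    intro t ht
    obtain ⟨a, ha⟩ := hfin (sol '' t) (by
      rintro _ ⟨p, hp, rfl⟩
      exact (ht hp).2) (t.finite_toSet.image _)
    exact ⟨a, fun p hp => ha _ ⟨p, hp, rfl⟩⟩)
  refine ⟨a, fun S hS => ?_⟩
  obtain ⟨n, φ, c, hc, rfl⟩ := definable_iff_params.1 (hdef S hS)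
  exact ha ⟨n, φ, c⟩ ⟨hc, hS⟩

/-! ### Trees of parameters and `SOP₂` -/

theorem definable_consistent {C : Set 𝕄} {r : ℕ} {ι : Type v} {Φ : Set (Fin r ⊕ ι → 𝕄)}
    (hΦ : C.Definable L Φ) {N : Type w} (F : Finset N) :
    C.Definable L {g : N × ι → 𝕄 |
      ∃ a : Fin r → 𝕄, ∀ x ∈ F, Sum.elim a (fun j => g (x, j)) ∈ Φ} := by
  have h : C.Definable L (⋂ x ∈ F, (fun g : (N × ι) ⊕ Fin r → 𝕄 =>
      g ∘ (Sum.elim Sum.inr fun j => Sum.inl (x, j))) ⁻¹' Φ) :=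
    Set.definable_biInter_finset (fun x => hΦ.preimage_comp _) F
  refine (congrArg (C.Definable L) ?_).mp h.exists_of_finite
  ext g
  refine exists_congr fun a => ?_
  simp only [Set.mem_iInter, Set.mem_preimage]
  refine forall₂_congr fun x _ => iff_of_eq (congrArg (· ∈ Φ) ?_)
  funext i
  rcases i with i | i <;> rfl

theorem tree_compactness {κ : Cardinal.{u}} (hκ : Cardinal.aleph0 < κ)
    (hsat : IsSaturated L 𝕄 κ) {r : ℕ} {ι : Type} [Finite ι] {Φ : Set (Fin r ⊕ ι → 𝕄)}
    (hΦ : (∅ : Set 𝕄).Definable L Φ) (𝓒 𝓘 : Set (Finset (List Bool)))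
    (h : ∀ n : ℕ, ∃ c : List Bool → ι → 𝕄,
      (∀ F ∈ 𝓒, (∀ x ∈ F, x.length < n) → ∃ a : Fin r → 𝕄, ∀ x ∈ F, Sum.elim a (c x) ∈ Φ) ∧
      (∀ F ∈ 𝓘, (∀ x ∈ F, x.length < n) → ¬ ∃ a : Fin r → 𝕄, ∀ x ∈ F, Sum.elim a (c x) ∈ Φ)) :
    ∃ c : List Bool → ι → 𝕄,
      (∀ F ∈ 𝓒, ∃ a : Fin r → 𝕄, ∀ x ∈ F, Sum.elim a (c x) ∈ Φ) ∧
      (∀ F ∈ 𝓘, ¬ ∃ a : Fin r → 𝕄, ∀ x ∈ F, Sum.elim a (c x) ∈ Φ) := by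
  let con : Finset (List Bool) → Set (ULift.{u} (List Bool × ι) → 𝕄) := fun F =>
    {g | ∃ a : Fin r → 𝕄, ∀ x ∈ F, Sum.elim a (fun j => g ⟨(x, j)⟩) ∈ Φ}
  have hcon : ∀ F, (∅ : Set 𝕄).Definable L (con F) := fun F =>
    (definable_consistent hΦ F).preimage_comp ULift.up
  obtain ⟨g, hg⟩ := saturation hsat (α := ULift.{u} (List Bool × ι)) (C := ∅)
    (lt_of_le_of_lt Cardinal.mk_le_aleph0 hκ) (by
      rw [Cardinal.mk_eq_zero]; exact lt_trans Cardinal.aleph0_pos hκ)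
    (con '' 𝓒 ∪ (fun F => (con F)ᶜ) '' 𝓘) (by
      rintro _ (⟨F, -, rfl⟩ | ⟨F, -, rfl⟩)
      exacts [hcon F, (hcon F).compl]) (by
      intro t ht hfin
      have : ∃ n : ℕ, ∀ S ∈ t, (∃ F ∈ 𝓒, (∀ x ∈ F, x.length < n) ∧ S = con F) ∨
          (∃ F ∈ 𝓘, (∀ x ∈ F, x.length < n) ∧ S = (con F)ᶜ) := by
        have hbd : ∀ F : Finset (List Bool), ∃ n : ℕ, ∀ x ∈ F, x.length < n := fun F =>
          ⟨F.sup List.length + 1, fun x hx => Nat.lt_succ_of_le (Finset.le_sup hx)⟩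
        induction t, hfin using Set.Finite.induction_on with
        | empty => exact ⟨0, by simp⟩
        | @insert S t _ _ ih =>
          obtain ⟨n, hn⟩ := ih ((Set.subset_insert _ _).trans ht)
          obtain ⟨n', hn'⟩ : ∃ n, (∃ F ∈ 𝓒, (∀ x ∈ F, x.length < n) ∧ S = con F) ∨
              (∃ F ∈ 𝓘, (∀ x ∈ F, x.length < n) ∧ S = (con F)ᶜ) := by
            rcases ht (Or.inl rfl) with ⟨F, hF, rfl⟩ | ⟨F, hF, rfl⟩
            · obtain ⟨n, hn⟩ := hbd F
              exact ⟨n, Or.inl ⟨F, hF, hn, rfl⟩⟩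
            · obtain ⟨n, hn⟩ := hbd F
              exact ⟨n, Or.inr ⟨F, hF, hn, rfl⟩⟩
          have hmono : ∀ (S : Set (ULift.{u} (List Bool × ι) → 𝕄)) (n m : ℕ), n ≤ m →
              ((∃ F ∈ 𝓒, (∀ x ∈ F, x.length < n) ∧ S = con F) ∨
                (∃ F ∈ 𝓘, (∀ x ∈ F, x.length < n) ∧ S = (con F)ᶜ)) →
              ((∃ F ∈ 𝓒, (∀ x ∈ F, x.length < m) ∧ S = con F) ∨
                (∃ F ∈ 𝓘, (∀ x ∈ F, x.length < m) ∧ S = (con F)ᶜ)) := by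
            rintro S n m hnm (⟨F, h1, h2, h3⟩ | ⟨F, h1, h2, h3⟩)
            · exact Or.inl ⟨F, h1, fun x hx => (h2 x hx).trans_le hnm, h3⟩
            · exact Or.inr ⟨F, h1, fun x hx => (h2 x hx).trans_le hnm, h3⟩
          refine ⟨max n n', ?_⟩
          rintro S' (rfl | hS')
          · exact hmono _ _ _ (le_max_right _ _) hn'
          · exact hmono _ _ _ (le_max_left _ _) (hn S' hS')
      obtain ⟨n, hn⟩ := this
      obtain ⟨c, hc1, hc2⟩ := h n
      refine ⟨fun p => c p.down.1 p.down.2, fun S hS => ?_⟩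
      rcases hn S hS with ⟨F, hF, hb, rfl⟩ | ⟨F, hF, hb, rfl⟩
      exacts [hc1 F hF hb, hc2 F hF hb])
  exact ⟨fun x j => g ⟨(x, j)⟩, fun F hF => hg _ (Or.inl ⟨F, hF, rfl⟩),
    fun F hF => hg _ (Or.inr ⟨F, hF, rfl⟩)⟩

theorem hasSOP2_of_tree {κ : Cardinal.{u}} (hκ : Cardinal.aleph0 < κ)
    (hsat : IsSaturated L 𝕄 κ) {r : ℕ} {ι : Type} [Finite ι] {Φ : Set (Fin r ⊕ ι → 𝕄)}
    (hΦ : (∅ : Set 𝕄).Definable L Φ) (c : List Bool → ι → 𝕄)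
    (hcon : ∀ w : List Bool, ∃ a : Fin r → 𝕄, ∀ x, x <+: w → Sum.elim a (c x) ∈ Φ)
    (hinc : ∀ η η' : List Bool, ¬ η <+: η' → ¬ η' <+: η →
      ¬ ∃ a : Fin r → 𝕄, Sum.elim a (c η) ∈ Φ ∧ Sum.elim a (c η') ∈ Φ) :
    HasSOP2 L 𝕄 := by
  obtain ⟨m, ⟨e⟩⟩ := Finite.exists_equiv_fin ι
  obtain ⟨φ, hφ⟩ := Set.empty_definable_iff.1 hΦ
  have key : ∀ (a : Fin r → 𝕄) x, (φ.relabel (Sum.map id e)).Realize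
      (Sum.elim a (c x ∘ e.symm)) ↔ Sum.elim a (c x) ∈ Φ := by
    intro a x
    rw [hφ, Formula.realize_relabel]
    refine iff_of_eq (congrArg φ.Realize ?_)
    funext i
    rcases i with i | i
    · rfl
    · simp
  refine ⟨r, m, φ.relabel (Sum.map id e), fun η => c η ∘ e.symm, fun σ => ?_,
    fun η η' h h' => ?_⟩
  · simp only [key]
    let C : Set 𝕄 := Set.range fun p : List Bool × ι => c p.1 p.2
    let o : ℕ → List Bool := fun n => List.ofFn fun i : Fin n => σ i
    have ho : ∀ i j, i ≤ j → o i <+: o j := by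
      intro i j hij
      rw [List.prefix_iff_eq_take]
      refine List.ext_getElem ?_ fun l h1 h2 => ?_
      · simp [o, hij]
      · simp [o]
    obtain ⟨a, ha⟩ := saturation hsat (α := ULift.{u} (Fin r)) (C := C)
      (lt_of_le_of_lt Cardinal.mk_le_aleph0 hκ)
      (lt_of_le_of_lt (Set.countable_range _).le_aleph0 hκ)
      (Set.range fun n => {g | Sum.elim (g ∘ ULift.up) (c (o n)) ∈ Φ}) (by
        rintro _ ⟨n, rfl⟩
        have h1 : C.Definable L {y : Fin r → 𝕄 | Sum.elim y (c (o n)) ∈ Φ} :=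
          (definable_union_range (C := ∅) (f := c (o n)).2 ⟨Φ, hΦ, rfl⟩).mono (by
            rintro x (hx | ⟨j, rfl⟩)
            · exact hx.elim
            · exact ⟨(o n, j), rfl⟩)
        exact h1.preimage_comp ULift.up) (by
        intro t ht hfin
        have : ∃ n, ∀ S ∈ t, ∃ i ≤ n, S =
            {g : ULift.{u} (Fin r) → 𝕄 | Sum.elim (g ∘ ULift.up) (c (o i)) ∈ Φ} := by
          induction t, hfin using Set.Finite.induction_on with
          | empty => exact ⟨0, by simp⟩
          | @insert S t _ _ ih =>
            obtain ⟨n, hn⟩ := ih ((Set.subset_insert _ _).trans ht)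
            obtain ⟨n', rfl⟩ := ht (Or.inl rfl)
            refine ⟨max n n', ?_⟩
            rintro S' (rfl | hS')
            · exact ⟨n', le_max_right _ _, rfl⟩
            · obtain ⟨i, hi, h⟩ := hn S' hS'
              exact ⟨i, hi.trans (le_max_left _ _), h⟩
        obtain ⟨n, hn⟩ := this
        obtain ⟨a, ha⟩ := hcon (o n)
        refine ⟨a ∘ ULift.down, fun S hS => ?_⟩
        obtain ⟨i, hi, rfl⟩ := hn S hS
        exact ha _ (ho _ _ hi))
    exact ⟨a ∘ ULift.up, fun n => ha _ ⟨n, rfl⟩⟩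
  · simp only [key]
    exact hinc η η' h h'

/-- `c 0, …, c (k - 1)` is a comb: each `c j` lies to the right of a node whose left cone
contains all earlier elements. -/
def IsComb (k : ℕ) (c : ℕ → List Bool) : Prop :=
  ∀ j < k, 0 < j → ∃ u, (∀ i < j, u ++ [false] <+: c i) ∧ u ++ [true] <+: c j

theorem hasSOP2_of_comb {κ : Cardinal.{u}} (hκ : Cardinal.aleph0 < κ)
    (hsat : IsSaturated L 𝕄 κ) (k : ℕ) {r : ℕ} {ι : Type} [Finite ι]
    {Φ : Set (Fin r ⊕ ι → 𝕄)}
    (hΦ : (∅ : Set 𝕄).Definable L Φ)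
    (h : ∀ n : ℕ, ∃ c : List Bool → ι → 𝕄,
      (∀ w : List Bool, w.length < n →
        ∃ a : Fin r → 𝕄, ∀ x, x <+: w → Sum.elim a (c x) ∈ Φ) ∧
      (∀ d, IsComb k d → (∀ i < k, (d i).length < n) →
        ¬ ∃ a : Fin r → 𝕄, ∀ i < k, Sum.elim a (c (d i)) ∈ Φ)) :
    HasSOP2 L 𝕄 := by
  classical
  induction k generalizing ι with
  | zero =>
    obtain ⟨c, hc, hd⟩ := h 1
    obtain ⟨a, -⟩ := hc [] (by simp)
    exact absurd ⟨a, by simp⟩ (hd (fun _ => []) (fun j hj => absurd hj (by simp)) (by simp))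
  | succ k ih =>
    obtain ⟨c, hc, hd⟩ : ∃ c : List Bool → ι → 𝕄,
        (∀ w : List Bool, ∃ a : Fin r → 𝕄, ∀ x, x <+: w → Sum.elim a (c x) ∈ Φ) ∧
        (∀ d, IsComb (k + 1) d → ¬ ∃ a : Fin r → 𝕄, ∀ i < k + 1, Sum.elim a (c (d i)) ∈ Φ) := by
      obtain ⟨c, h1, h2⟩ := tree_compactness hκ hsat hΦ
        (Set.range fun w : List Bool => w.inits.toFinset)
        ((fun d => (Finset.range (k + 1)).image d) '' {d | IsComb (k + 1) d}) (by
          intro n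
          obtain ⟨c, h1, h2⟩ := h n
          refine ⟨c, ?_, ?_⟩
          · rintro _ ⟨w, rfl⟩ hw
            simpa using h1 w (hw w (by simp))
          · rintro _ ⟨d, hd, rfl⟩ hn
            simpa using h2 d hd (by simpa using hn))
      refine ⟨c, fun w => ?_, fun d hd => ?_⟩
      · simpa using h1 _ ⟨w, rfl⟩
      · simpa using h2 _ ⟨d, hd, rfl⟩
    rcases Nat.eq_zero_or_pos k with rfl | hk
    · obtain ⟨a, ha⟩ := hc []
      refine absurd ⟨a, ?_⟩ (hd (fun _ => []) (fun j hj h0 => by omega))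
      exact fun i _ => ha _ List.prefix_rfl
    rcases comb_or_blocks (fun (a : Fin r → 𝕄) x => Sum.elim a (c x) ∈ Φ) with H | ⟨N, H⟩
    · let Φ' : Set (Fin r ⊕ (ι ⊕ ι) → 𝕄) :=
        (fun g => g ∘ Sum.map id Sum.inl) ⁻¹' Φ ∩ (fun g => g ∘ Sum.map id Sum.inr) ⁻¹' Φ
      have hΦ' : ∀ (a : Fin r → 𝕄) (y z : ι → 𝕄), Sum.elim a (Sum.elim y z) ∈ Φ' ↔
          Sum.elim a y ∈ Φ ∧ Sum.elim a z ∈ Φ := by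
        intro a y z
        simp [Φ', Set.mem_inter_iff, Set.mem_preimage, Sum.elim_comp_map]
      refine ih (Φ := Φ') ((hΦ.preimage_comp _).inter (hΦ.preimage_comp _)) fun n => ?_
      obtain ⟨a, u, f, z, hu, h1, h2, h3⟩ := H n
      refine ⟨fun η => Sum.elim (c (f η)) (c a), fun w hw => ?_, fun d hcomb hlen => ?_⟩
      · obtain ⟨x, hx, hx'⟩ := h3 w hw
        exact ⟨x, fun y hy => (hΦ' _ _ _).2 ⟨hx' y hy, hx⟩⟩
      · rintro ⟨x, hx⟩
        simp only [hΦ'] at hx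
        refine hd (fun i => if i < k then f (d i) else a) ?_ ⟨x, fun i hi => ?_⟩
        · intro j hj h0
          rcases Nat.lt_or_ge j k with hjk | hjk
          · obtain ⟨v, hv, hv'⟩ := hcomb j hjk h0
            have key : ∀ i < k, ∀ c, v ++ [c] <+: d i → z v ++ [c] <+: f (d i) := by
              rintro i hi c ⟨σ, hσ⟩
              have := h2 v c σ (by have := hlen i hi; rw [← hσ] at this; simpa using this)
              rw [← hσ]
              simpa using this
            refine ⟨z v, fun i hi => ?_, ?_⟩
            · simp only [if_pos (hi.trans hjk)]
              exact key i (hi.trans hjk) _ (hv i hi)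
            · simp only [if_pos hjk]
              exact key j hjk _ hv'
          · refine ⟨u, fun i hi => ?_, ?_⟩
            · simp only [if_pos (show i < k by omega)]
              exact h1 _ (hlen i (by omega))
            · simpa only [if_neg (show ¬ j < k by omega)] using hu
        · split_ifs with hik
          · exact (hx i hik).1
          · exact (hx 0 hk).2
    · let Φ' : Set (Fin r ⊕ (Fin N × ι) → 𝕄) :=
        ⋂ i : Fin N, (fun g => g ∘ Sum.map id fun j => (i, j)) ⁻¹' Φ
      have hΦ' : ∀ (a : Fin r → 𝕄) (y : Fin N × ι → 𝕄), Sum.elim a y ∈ Φ' ↔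
          ∀ i, Sum.elim a (fun j => y (i, j)) ∈ Φ := by
        intro a y
        simp only [Φ', Set.mem_iInter, Set.mem_preimage, Sum.elim_comp_map]
        rfl
      have hdef : (∅ : Set 𝕄).Definable L Φ' :=
        Set.definable_iInter_of_finite fun i => hΦ.preimage_comp _
      obtain ⟨c', h1, h2⟩ := tree_compactness hκ hsat hdef
        (Set.range fun w : List Bool => w.inits.toFinset)
        {F | ∃ η η' : List Bool, ¬ η <+: η' ∧ ¬ η' <+: η ∧ F = {η, η'}} (by
          intro n
          obtain ⟨F, hF, hF'⟩ := H n
          refine ⟨fun η p => c (F η p.1) p.2, ?_, ?_⟩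
          · rintro _ ⟨w, rfl⟩ hw
            obtain ⟨w', hw'⟩ := hF w (hw w (by simp))
            obtain ⟨a, ha⟩ := hc w'
            refine ⟨a, fun x hx => (hΦ' _ _).2 fun i => ha _ (hw' x (by simpa using hx) i i.2)⟩
          · rintro _ ⟨η, η', h1, h2, rfl⟩ hn ⟨a, ha⟩
            simp only [hΦ'] at ha
            exact hF' η η' (hn _ (by simp)) (hn _ (by simp)) h1 h2
              ⟨a, fun i hi => ⟨ha η (by simp) ⟨i, hi⟩, ha η' (by simp) ⟨i, hi⟩⟩⟩)
      refine hasSOP2_of_tree hκ hsat hdef c' (fun w => ?_) (fun η η' hη hη' => ?_)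
      · simpa using h1 _ ⟨w, rfl⟩
      · simpa using h2 _ ⟨η, η', hη, hη', rfl⟩

end Definable

/-! ### Ultrafilters as coheirs -/

section Coheirs

variable {L : FirstOrder.Language.{u, u}} {𝕄 : Type u} [L.Structure 𝕄]

/-- `a` lies in every `C`-definable set belonging to the filter `𝒱`. -/
def RealizesFilter (L : FirstOrder.Language.{u, u}) {𝕄 : Type u} [L.Structure 𝕄] {α : Type v}
    (𝒱 : Filter (α → 𝕄)) (C : Set 𝕄) (a : α → 𝕄) : Prop :=
  ∀ S, C.Definable L S → S ∈ 𝒱 → a ∈ S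

/-- The filter `𝒱` of `α`-tuples contains the set of tuples from `Ms`. -/
def Concentrates {α : Type v} (𝒱 : Filter (α → 𝕄)) (Ms : Set 𝕄) : Prop :=
  {y : α → 𝕄 | ∀ i, y i ∈ Ms} ∈ 𝒱

/-- The filter generated by the `C`-definable sets containing `a`. -/
def typeFilter (L : FirstOrder.Language.{u, u}) {𝕄 : Type u} [L.Structure 𝕄] {α : Type v}
    (C : Set 𝕄) (a : α → 𝕄) : Filter (α → 𝕄) where
  sets := {X | ∃ S, C.Definable L S ∧ a ∈ S ∧ S ⊆ X}
  univ_sets := ⟨Set.univ, Set.definable_univ, trivial, subset_rfl⟩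
  sets_of_superset := fun ⟨S, h1, h2, h3⟩ h => ⟨S, h1, h2, h3.trans h⟩
  inter_sets := fun ⟨S, h1, h2, h3⟩ ⟨T, h4, h5, h6⟩ =>
    ⟨S ∩ T, h1.inter h4, ⟨h2, h5⟩, Set.inter_subset_inter h3 h6⟩

theorem RealizesFilter.mono {α : Type v} {𝒱 : Filter (α → 𝕄)} {C C' : Set 𝕄} {a : α → 𝕄}
    (h : RealizesFilter L 𝒱 C a) (hC : C' ⊆ C) : RealizesFilter L 𝒱 C' a :=
  fun S hS => h S (hS.mono hC)

theorem RealizesFilter.mem_iff {α : Type v} {𝒱 : Ultrafilter (α → 𝕄)} {C : Set 𝕄} {a : α → 𝕄}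
    (h : RealizesFilter L (𝒱 : Filter (α → 𝕄)) C a) {S : Set (α → 𝕄)} (hS : C.Definable L S) :
    a ∈ S ↔ S ∈ 𝒱 := by
  refine ⟨fun ha => ?_, h S hS⟩
  by_contra hS'
  exact h _ hS.compl (Ultrafilter.compl_mem_iff_notMem.2 hS') ha

theorem realizesFilter_of_le_typeFilter {α : Type v} {𝒱 : Ultrafilter (α → 𝕄)} {C : Set 𝕄}
    {a : α → 𝕄} (h : (𝒱 : Filter (α → 𝕄)) ≤ typeFilter L C a) :
    RealizesFilter L (𝒱 : Filter (α → 𝕄)) C a := by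
  intro S hS hS𝒱
  by_contra ha
  exact Ultrafilter.compl_mem_iff_notMem.1 (h ⟨Sᶜ, hS.compl, ha, subset_rfl⟩) hS𝒱

theorem RealizesFilter.eqTpOver {α : Type v} {𝒱 : Ultrafilter (α → 𝕄)} {C : Set 𝕄}
    {a b : α → 𝕄} (ha : RealizesFilter L (𝒱 : Filter (α → 𝕄)) C a)
    (hb : RealizesFilter L (𝒱 : Filter (α → 𝕄)) C b) : EqTpOver L C a b :=
  eqTpOver_iff.2 fun _ hS => (ha.mem_iff hS).trans (hb.mem_iff hS).symm

theorem RealizesFilter.of_eqTpOver {α : Type v} {𝒱 : Filter (α → 𝕄)} {C : Set 𝕄}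
    {a b : α → 𝕄} (ha : RealizesFilter L 𝒱 C a) (hab : EqTpOver L C a b) :
    RealizesFilter L 𝒱 C b :=
  fun S hS hS𝒱 => (eqTpOver_iff.1 hab S hS).1 (ha S hS hS𝒱)

theorem RealizesFilter.comp {α : Type v} {β : Type w} {𝒱 : Filter (α → 𝕄)}
    {𝒲 : Filter (β → 𝕄)} {C : Set 𝕄} {a : α → 𝕄} (ha : RealizesFilter L 𝒱 C a) (ρ : β → α)
    (h : ∀ S, C.Definable L S → S ∈ 𝒲 → {g : α → 𝕄 | g ∘ ρ ∈ S} ∈ 𝒱) :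
    RealizesFilter L 𝒲 C (a ∘ ρ) :=
  fun S hS hS𝒲 => ha _ (hS.preimage_comp ρ) (h S hS hS𝒲)

theorem exists_realizesFilter_of_finSatIn {α : Type v} {Ms C : Set 𝕄} {a : α → 𝕄}
    (h : FinSatIn L Ms a C) :
    ∃ 𝒱 : Ultrafilter (α → 𝕄), Concentrates (𝒱 : Filter (α → 𝕄)) Ms ∧
      RealizesFilter L (𝒱 : Filter (α → 𝕄)) C a := by
  have : (typeFilter L C a ⊓ Filter.principal {y : α → 𝕄 | ∀ i, y i ∈ Ms}).NeBot := by
    refine Filter.inf_principal_neBot_iff.2 ?_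
    rintro X ⟨S, hS, ha, hSX⟩
    obtain ⟨y, hy, hy'⟩ := finSatIn_iff.1 h S hS ha
    exact ⟨y, hSX hy, hy'⟩
  obtain ⟨𝒱, h𝒱⟩ := Ultrafilter.exists_le
    (typeFilter L C a ⊓ Filter.principal {y : α → 𝕄 | ∀ i, y i ∈ Ms})
  exact ⟨𝒱, (h𝒱.trans inf_le_right) (Filter.mem_principal_self _),
    realizesFilter_of_le_typeFilter (h𝒱.trans inf_le_left)⟩

theorem exists_ultrafilter_of_finite_inter {α : Type v} {Ms : Set 𝕄} (𝒢 : Set (Set (α → 𝕄)))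
    (h : ∀ t ⊆ 𝒢, t.Finite → ∃ y ∈ ⋂₀ t, ∀ i, y i ∈ Ms) :
    ∃ 𝒱 : Ultrafilter (α → 𝕄), Concentrates (𝒱 : Filter (α → 𝕄)) Ms ∧ ∀ S ∈ 𝒢, S ∈ 𝒱 := by
  have : (Filter.generate 𝒢 ⊓ Filter.principal {y : α → 𝕄 | ∀ i, y i ∈ Ms}).NeBot := by
    refine Filter.inf_principal_neBot_iff.2 fun X hX => ?_
    obtain ⟨t, ht, hfin, htX⟩ := Filter.mem_generate_iff.1 hX
    obtain ⟨y, hy, hy'⟩ := h t ht hfin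
    exact ⟨y, htX hy, hy'⟩
  obtain ⟨𝒱, h𝒱⟩ := Ultrafilter.exists_le
    (Filter.generate 𝒢 ⊓ Filter.principal {y : α → 𝕄 | ∀ i, y i ∈ Ms})
  exact ⟨𝒱, (h𝒱.trans inf_le_right) (Filter.mem_principal_self _), fun S hS =>
    (h𝒱.trans inf_le_left) (Filter.mem_generate_of_mem hS)⟩

theorem exists_ultrafilter_of_globalType {α : Type v} {Ms : Set 𝕄} {q : GlobalType L 𝕄 α}
    (hq : q.FinSatInM Ms) :
    ∃ 𝒱 : Ultrafilter (α → 𝕄), Concentrates (𝒱 : Filter (α → 𝕄)) Ms ∧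
      ∀ C a, RealizesType q a C ↔ RealizesFilter L (𝒱 : Filter (α → 𝕄)) C a := by
  classical
  let sol : FmlP L 𝕄 α → Set (α → 𝕄) := fun p => {a | p.2.1.Realize (Sum.elim a p.2.2)}
  obtain ⟨𝒱, hconc, h𝒱⟩ := exists_ultrafilter_of_finite_inter (Ms := Ms) (sol '' q.carrier) (by
    intro t ht hfin
    lift t to Finset (Set (α → 𝕄)) using hfin
    obtain ⟨t', ht', rfl⟩ := Finset.subset_set_image_iff.1 ht
    obtain ⟨y, hy, hy'⟩ := hq t' ht'
    refine ⟨y, ?_, hy⟩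
    rw [Finset.coe_image]
    rintro _ ⟨p, hp, rfl⟩
    exact hy' p hp)
  have key : ∀ p, p ∈ q.carrier ↔ sol p ∈ 𝒱 := by
    rintro ⟨n, φ, c⟩
    refine ⟨fun hp => h𝒱 _ ⟨_, hp, rfl⟩, fun hp => ?_⟩
    refine (q.complete n φ c).resolve_right fun hn => ?_
    exact Ultrafilter.compl_mem_iff_notMem.1 (h𝒱 _ ⟨_, hn, rfl⟩) hp
  refine ⟨𝒱, hconc, fun C a => ⟨fun h S hS hS𝒱 => ?_, fun h n φ c hc hp => ?_⟩⟩
  · obtain ⟨n, φ, c, hc, rfl⟩ := definable_iff_params.1 hS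
    exact h n φ c hc ((key ⟨n, φ, c⟩).2 hS𝒱)
  · exact h _ (definable_iff_params.2 ⟨n, φ, c, hc, rfl⟩) ((key ⟨n, φ, c⟩).1 hp)

theorem exists_globalType_of_ultrafilter {α : Type v} {Ms : Set 𝕄}
    (𝒱 : Ultrafilter (α → 𝕄)) (hconc : Concentrates (𝒱 : Filter (α → 𝕄)) Ms) :
    ∃ q : GlobalType L 𝕄 α, q.FinSatInM Ms ∧
      ∀ C a, RealizesFilter L (𝒱 : Filter (α → 𝕄)) C a → RealizesType q a C := by
  have hfin : ∀ t : Finset (FmlP L 𝕄 α),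
      ↑t ⊆ {p : FmlP L 𝕄 α | {a | p.2.1.Realize (Sum.elim a p.2.2)} ∈ 𝒱} →
      ∃ m : α → 𝕄, (∀ i, m i ∈ Ms) ∧ ∀ p ∈ t, p.2.1.Realize (Sum.elim m p.2.2) := by
    intro t ht
    have h1 : (⋂ p ∈ t, {a : α → 𝕄 | p.2.1.Realize (Sum.elim a p.2.2)}) ∈
        (𝒱 : Filter (α → 𝕄)) := (Filter.biInter_finset_mem t).2 fun p hp => ht hp
    obtain ⟨y, hy, hy'⟩ := 𝒱.nonempty_of_mem (Filter.inter_mem h1 hconc)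
    exact ⟨y, hy', fun p hp => Set.mem_iInter₂.1 hy p hp⟩
  refine ⟨⟨{p | {a | p.2.1.Realize (Sum.elim a p.2.2)} ∈ 𝒱}, fun t ht => ?_, fun n φ c => ?_⟩,
    hfin, fun C a h n φ c hc hp => h _ (definable_iff_params.2 ⟨n, φ, c, hc, rfl⟩) hp⟩
  · obtain ⟨y, -, hy⟩ := hfin t ht
    exact ⟨y, hy⟩
  · exact 𝒱.mem_or_compl_mem _

theorem Concentrates.fiber_mem {α : Type v} {β : Type w} {𝒱 : Filter (α → 𝕄)} {Ms : Set 𝕄}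
    (hconc : Concentrates 𝒱 Ms) {f f' : β → 𝕄} (hf : EqTpOver L Ms f f')
    {S : Set (α ⊕ β → 𝕄)} (hS : Ms.Definable L S) (h : {y | Sum.elim y f ∈ S} ∈ 𝒱) :
    {y | Sum.elim y f' ∈ S} ∈ 𝒱 := by
  filter_upwards [h, hconc] with y hy hyM
  exact (eqTpOver_iff.1 hf _ (definable_fiber hS hyM)).1 hy

theorem eqTpOver_sumElim {α : Type v} {β : Type w} {𝒱 : Ultrafilter (α → 𝕄)} {Ms : Set 𝕄}
    (hconc : Concentrates (𝒱 : Filter (α → 𝕄)) Ms) {f f' : β → 𝕄} (hf : EqTpOver L Ms f f')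
    {a a' : α → 𝕄} (ha : RealizesFilter L (𝒱 : Filter (α → 𝕄)) (Ms ∪ Set.range f) a)
    (ha' : RealizesFilter L (𝒱 : Filter (α → 𝕄)) (Ms ∪ Set.range f') a') :
    EqTpOver L Ms (Sum.elim a f) (Sum.elim a' f') := by
  refine eqTpOver_iff.2 fun S hS => ?_
  exact (ha.mem_iff (definable_union_range.2 ⟨S, hS, rfl⟩)).trans (Iff.trans
    ⟨hconc.fiber_mem hf hS, hconc.fiber_mem hf.symm hS⟩
    (ha'.mem_iff (definable_union_range.2 ⟨S, hS, rfl⟩)).symm)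

/-- Realizing a filter concentrated on `Ms` over `Ms` and a tuple only depends on the joint type
over `Ms`. -/
theorem RealizesFilter.transfer {α : Type*} {β : Type*} {γ : Type*} {𝒱 : Filter (α → 𝕄)}
    {Ms : Set 𝕄} (hconc : Concentrates 𝒱 Ms) {g g' : γ → 𝕄} (hg : EqTpOver L Ms g g')
    (ρ : α → γ) (τ : β → γ) (h : RealizesFilter L 𝒱 (Ms ∪ Set.range (g ∘ τ)) (g ∘ ρ)) :
    RealizesFilter L 𝒱 (Ms ∪ Set.range (g' ∘ τ)) (g' ∘ ρ) := by
  intro S hS hS𝒱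
  obtain ⟨S', hS', rfl⟩ := definable_union_range.1 hS
  have h1 := h _ (definable_union_range.2 ⟨S', hS', rfl⟩)
    (hconc.fiber_mem (hg.comp τ).symm hS' hS𝒱)
  have h2 := (eqTpOver_iff.1 hg _ (hS'.preimage_comp (Sum.elim ρ τ))).1 (by
    rw [Set.mem_preimage, Sum.comp_elim]
    exact h1)
  rwa [Set.mem_preimage, Sum.comp_elim] at h2

end Coheirs

/-! ### Automorphisms and Morley sequences in the monster model -/

section Monster

variable {L : FirstOrder.Language.{u, u}} {𝕄 : Type u} [L.Structure 𝕄] {κ : Cardinal.{u}}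

theorem exists_aut_of_eqTpOver (hm : IsMonster L 𝕄 κ) {Ms : Set 𝕄} (hMs : Cardinal.mk Ms < κ)
    {α : Type u} (hα : Cardinal.mk α < κ) {a b : α → 𝕄} (h : EqTpOver L Ms a b) :
    ∃ σ : 𝕄 ≃[L] 𝕄, (∀ x ∈ Ms, σ x = x) ∧ ∀ i, σ (a i) = b i := by
  obtain ⟨σ, hσ⟩ := hm.2.2 (Ms ⊕ α) (by
    rw [Cardinal.mk_sum, Cardinal.lift_id, Cardinal.lift_id]
    exact Cardinal.add_lt_of_lt hm.1.le hMs hα)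
    (Sum.elim Subtype.val a) (Sum.elim Subtype.val b) (eqTpOver_iff.2 fun S hS =>
      eqTpOver_iff.1 h _ (definable_fiber (hS.mono (Set.empty_subset Ms)) Subtype.prop))
  exact ⟨σ, fun x hx => hσ (Sum.inl ⟨x, hx⟩), fun i => hσ (Sum.inr i)⟩

theorem eqTpOver_aut {Ms : Set 𝕄} {α : Type v} (σ : 𝕄 ≃[L] 𝕄) (hσ : ∀ x ∈ Ms, σ x = x)
    (a : α → 𝕄) : EqTpOver L Ms a fun i => σ (a i) :=
  eqTpOver_iff.2 fun _ hS => (definable_aut hS σ hσ a).symm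

theorem exists_realizesFilter (hsat : IsSaturated L 𝕄 κ) {α : Type u} (hα : Cardinal.mk α < κ)
    (𝒱 : Filter (α → 𝕄)) [𝒱.NeBot] {C : Set 𝕄} (hC : Cardinal.mk C < κ) :
    ∃ a, RealizesFilter L 𝒱 C a := by
  obtain ⟨a, ha⟩ := saturation hsat hα hC {S | C.Definable L S ∧ S ∈ 𝒱} (fun S hS => hS.1)
    (fun t ht hfin => Filter.nonempty_of_mem ((Filter.sInter_mem hfin).2 fun S hS => (ht hS).2))
  exact ⟨a, fun S h1 h2 => ha S ⟨h1, h2⟩⟩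

theorem exists_morley (hm : IsMonster L 𝕄 κ) {Ms : Set 𝕄} (hMs : Cardinal.mk Ms < κ)
    {α : Type u} [Countable α] (𝒲 : Ultrafilter (α → 𝕄)) {J : α → 𝕄}
    (hJ : RealizesFilter L (𝒲 : Filter (α → 𝕄)) Ms J) :
    ∃ I : ℕ → α → 𝕄, I 0 = J ∧ ∀ i, RealizesFilter L (𝒲 : Filter (α → 𝕄))
      (Ms ∪ ⋃ (j : ℕ) (_ : j < i), Set.range (I j)) (I i) := by
  classical
  have hα : Cardinal.mk α < κ := lt_of_le_of_lt Cardinal.mk_le_aleph0 hm.1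
  have hreal : ∀ C : Set 𝕄, ∃ a, Cardinal.mk C < κ →
      RealizesFilter L (𝒲 : Filter (α → 𝕄)) C a := by
    intro C
    by_cases hC : Cardinal.mk C < κ
    · obtain ⟨a, ha⟩ := exists_realizesFilter hm.2.1 hα (𝒲 : Filter (α → 𝕄)) hC
      exact ⟨a, fun _ => ha⟩
    · exact ⟨J, fun h => absurd h hC⟩
  choose g hg using hreal
  let st : ℕ → Set 𝕄 × (α → 𝕄) := fun n =>
    Nat.rec (Ms, J) (fun _ p => (p.1 ∪ Set.range p.2, g (p.1 ∪ Set.range p.2))) n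
  have h1 : ∀ n, (st n).1 = Ms ∪ ⋃ (j : ℕ) (_ : j < n), Set.range (st j).2 := by
    intro n
    induction n with
    | zero => simp [st]
    | succ n ih =>
      rw [Set.biUnion_lt_succ, ← Set.union_assoc, ← ih]
  have h2 : ∀ n, Cardinal.mk (st n).1 < κ := by
    intro n
    induction n with
    | zero => exact hMs
    | succ n ih =>
      refine (Cardinal.mk_union_le _ _).trans_lt (Cardinal.add_lt_of_lt hm.1.le ih ?_)
      exact (Set.countable_range _).le_aleph0.trans_lt hm.1
  refine ⟨fun n => (st n).2, rfl, fun n => ?_⟩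
  rw [← h1]
  cases n with
  | zero => exact hJ
  | succ n => exact hg _ (h2 (n + 1))

theorem biUnion_range_eq {α : Type v} (I : ℕ → α → 𝕄) (n : ℕ) :
    (⋃ (j : ℕ) (_ : j < n), Set.range (I j)) =
      Set.range (flatSeq I ∘ fun p : Fin n × α => ((p.1 : ℕ), p.2)) := by
  ext x
  simp only [Set.mem_iUnion, Set.mem_range, Function.comp_apply, flatSeq, Prod.exists]
  constructor
  · rintro ⟨j, hj, i, rfl⟩
    exact ⟨⟨j, hj⟩, i, rfl⟩
  · rintro ⟨j, i, rfl⟩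
    exact ⟨j, j.2, i, rfl⟩

theorem coheirMorley_of_realizesFilter {Ms : Set 𝕄} {α : Type v} (𝒲 : Ultrafilter (α → 𝕄))
    (hconc : Concentrates (𝒲 : Filter (α → 𝕄)) Ms) {I I' : ℕ → α → 𝕄}
    (hI : ∀ i, RealizesFilter L (𝒲 : Filter (α → 𝕄))
      (Ms ∪ ⋃ (j : ℕ) (_ : j < i), Set.range (I j)) (I i))
    (hII' : EqTpOver L Ms (flatSeq I) (flatSeq I')) : CoheirMorley L Ms I' := by
  obtain ⟨q, hq, hq'⟩ := exists_globalType_of_ultrafilter (L := L) 𝒲 hconc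
  refine ⟨q, hq, fun i => hq' _ _ ?_⟩
  have := hI i
  rw [biUnion_range_eq] at this ⊢
  exact this.transfer hconc hII' (Prod.mk i) _

/-! ### Canonical tuples -/

/-- `J` is a family of tuples such that for each small `d` there is `J' ≡ J` over `Ms`, all
of whose members realize `𝒱` over `Ms` and `d`, with `d` independent from `J'`. -/
def CanonicalTuple (R : IndRel L 𝕄) (κ : Cardinal.{u}) (Ms : Set 𝕄) {m : ℕ}
    (𝒱 : Filter (Fin m → 𝕄)) {ι : Type u} (J : ι × Fin m → 𝕄) : Prop :=
  ∀ (β : Type u), Cardinal.mk β < κ → ∀ d : β → 𝕄, ∃ J' : ι × Fin m → 𝕄, EqTpOver L Ms J J' ∧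
    R.rel (Set.range d) Ms (Set.range J') ∧
      ∀ i, RealizesFilter L 𝒱 (Ms ∪ Set.range d) fun j => J' (i, j)

variable {R : IndRel L 𝕄} {Ms : Set 𝕄} {m : ℕ} {𝒱 : Ultrafilter (Fin m → 𝕄)}

theorem CanonicalTuple.realizesFilter (hm : IsMonster L 𝕄 κ) {ι : Type u} {J : ι × Fin m → 𝕄}
    (hJ : CanonicalTuple R κ Ms (𝒱 : Filter (Fin m → 𝕄)) J) (i : ι) :
    RealizesFilter L (𝒱 : Filter (Fin m → 𝕄)) Ms fun j => J (i, j) := by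
  obtain ⟨J', h1, -, h2⟩ := hJ PEmpty (by
    rw [Cardinal.mk_pempty]; exact Cardinal.aleph0_pos.trans hm.1) PEmpty.elim
  exact ((h2 i).mono Set.subset_union_left).of_eqTpOver (h1.symm.comp (Prod.mk i))

theorem exists_canonicalTuple (hm : IsMonster L 𝕄 κ) (hMs : Cardinal.mk Ms < κ)
    (hcan : ∀ (β : Type u), Cardinal.mk β < κ → ∀ (d : β → 𝕄) (c : Fin m → 𝕄),
      RealizesFilter L (𝒱 : Filter (Fin m → 𝕄)) (Ms ∪ Set.range d) c →
        R.rel (Set.range d) Ms (Set.range c))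
    {b : Fin m → 𝕄} (hb : RealizesFilter L (𝒱 : Filter (Fin m → 𝕄)) Ms b) :
    CanonicalTuple R κ Ms (𝒱 : Filter (Fin m → 𝕄))
      (fun p : PUnit.{u + 1} × Fin m => b p.2) := by
  intro β hβ d
  let 𝒲 : Ultrafilter (PUnit.{u + 1} × Fin m → 𝕄) := 𝒱.map fun g p => g p.2
  obtain ⟨c, hc⟩ := exists_realizesFilter (C := Ms ∪ Set.range d) hm.2.1
    (lt_of_le_of_lt Cardinal.mk_le_aleph0 hm.1) (𝒲 : Filter (PUnit.{u + 1} × Fin m → 𝕄))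
    ((Cardinal.mk_union_le _ _).trans_lt (Cardinal.add_lt_of_lt hm.1.le hMs
      (Cardinal.mk_range_le.trans_lt hβ)))
  have hc' : RealizesFilter L (𝒱 : Filter (Fin m → 𝕄)) (Ms ∪ Set.range d)
      (c ∘ Prod.mk PUnit.unit) := hc.comp _ fun S _ hS => hS
  have hcc : c = (c ∘ Prod.mk PUnit.unit) ∘ Prod.snd := rfl
  refine ⟨c, ?_, ?_, fun i => hc'⟩
  · rw [hcc]
    exact (hb.eqTpOver (hc'.mono Set.subset_union_left)).comp Prod.snd
  · have := hcan β hβ d _ hc'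
    rwa [show Set.range (c ∘ Prod.mk PUnit.unit) = Set.range c from
      (show Function.Surjective (Prod.mk (β := Fin m) PUnit.unit.{u + 1}) from
        fun p => ⟨p.2, rfl⟩).range_comp c] at this

theorem CanonicalTuple.exists_ultrafilter (hm : IsMonster L 𝕄 κ) (hMs : IsElemSubmodel L Ms)
    (hR : R.StrongerThanH) {ι : Type u} {J : ι × Fin m → 𝕄}
    (hJ : CanonicalTuple R κ Ms (𝒱 : Filter (Fin m → 𝕄)) J) :
    ∃ 𝒲 : Ultrafilter (ι × Fin m → 𝕄), Concentrates (𝒲 : Filter (ι × Fin m → 𝕄)) Ms ∧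
      RealizesFilter L (𝒲 : Filter (ι × Fin m → 𝕄)) Ms J ∧
      ∀ (i : ι) (C : Set 𝕄) (S : Set (Fin m → 𝕄)), C.Definable L S → S ∈ 𝒱 →
        {g : ι × Fin m → 𝕄 | (fun j => g (i, j)) ∈ S} ∈ 𝒲 := by
  let 𝒢 : Set (Set (ι × Fin m → 𝕄)) := {S | Ms.Definable L S ∧ J ∈ S} ∪
    {S | ∃ i C S', Set.Definable C L S' ∧ S' ∈ 𝒱 ∧ S = {g | (fun j => g (i, j)) ∈ S'}}
  obtain ⟨𝒲, hconc, h𝒲⟩ := exists_ultrafilter_of_finite_inter (Ms := Ms) 𝒢 (by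
    intro t ht hfin
    have hA : ∀ S ∈ t, ∃ A : Set 𝕄, A.Finite ∧ ((Ms.Definable L S ∧ J ∈ S) ∨
        ∃ i S', A.Definable L S' ∧ S' ∈ 𝒱 ∧ S = {g | (fun j => g (i, j)) ∈ S'}) := by
      intro S hS
      rcases ht hS with h | ⟨i, C, S', h1, h2, h3⟩
      · exact ⟨∅, Set.finite_empty, Or.inl h⟩
      · obtain ⟨A, -, hA⟩ := Set.definable_iff_finitely_definable.1 h1
        exact ⟨A, A.finite_toSet, Or.inr ⟨i, S', hA, h2, h3⟩⟩
    choose! A hAfin hA using hA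
    let D : Set 𝕄 := ⋃ S ∈ t, A S
    have hD : D.Finite := hfin.biUnion hAfin
    obtain ⟨J', h1, h2, h3⟩ := hJ D
      (hD.countable.le_aleph0.trans_lt hm.1) Subtype.val
    rw [Subtype.range_coe] at h2 h3
    have h4 : (Ms ∪ D).Definable L (⋂₀ t) ∧ J' ∈ ⋂₀ t := by
      refine ⟨definable_finite_biInter hfin fun S hS => ?_, fun S hS => ?_⟩
      · rcases hA S hS with h | ⟨i, S', h, -, rfl⟩
        · exact h.1.mono Set.subset_union_left
        · exact (h.mono ((Set.subset_biUnion_of_mem hS).trans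
            Set.subset_union_right)).preimage_comp (Prod.mk i)
      · rcases hA S hS with h | ⟨i, S', h, h', heq⟩
        · exact (eqTpOver_iff.1 h1 S h.1).1 h.2
        · rw [heq]
          exact h3 i S' (h.mono ((Set.subset_biUnion_of_mem hS).trans
            Set.subset_union_right)) h'
    have h5 := finSatIn_iff.1 (hR _ _ _ hMs h2) {g | (fun p => g ⟨J' p, p, rfl⟩) ∈ ⋂₀ t}
      (h4.1.preimage_comp _) h4.2
    obtain ⟨y, hy, hy'⟩ := h5
    exact ⟨_, hy, fun p => hy' _⟩)
  refine ⟨𝒲, hconc, fun S hS hS𝒲 => ?_, fun i C S hS hS' => h𝒲 _ (Or.inr ⟨i, C, S, hS, hS', rfl⟩)⟩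
  by_contra hJS
  exact Ultrafilter.compl_mem_iff_notMem.1 (h𝒲 _ (Or.inl ⟨hS.compl, hJS⟩)) hS𝒲

theorem definable_eq_const {α : Type v} {C : Set 𝕄} (x : α) {c : 𝕄} (hc : c ∈ C) :
    C.Definable L {g : α → 𝕄 | g x = c} := by
  have h : C.Definable L {h : Fin 2 → 𝕄 | h 0 = h 1} :=
    (Set.empty_definable_iff.2 ⟨(Term.var 0).equal (Term.var 1), by
      ext g; simp [Formula.realize_equal]⟩).mono (Set.empty_subset C)
  exact definable_subst h fun i => if i = 0 then Sum.inr x else Sum.inl ⟨c, hc⟩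

theorem exists_ultrafilter_extending (hMs : IsElemSubmodel L Ms) {ι : Type u}
    (J : ι × Fin m → 𝕄) (i₀ : ι) (𝒰 : Ultrafilter (Fin m → 𝕄))
    (hconc : Concentrates (𝒰 : Filter (Fin m → 𝕄)) Ms)
    (hJ : RealizesFilter L (𝒰 : Filter (Fin m → 𝕄)) Ms fun j => J (i₀, j)) :
    ∃ 𝒲 : Ultrafilter (ι × Fin m → 𝕄), Concentrates (𝒲 : Filter (ι × Fin m → 𝕄)) Ms ∧
      RealizesFilter L (𝒲 : Filter (ι × Fin m → 𝕄)) Ms J ∧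
      ∀ S ∈ 𝒰, {g : ι × Fin m → 𝕄 | (fun j => g (i₀, j)) ∈ S} ∈ 𝒲 := by
  let F : Filter (ι × Fin m → 𝕄) := Filter.comap (fun g j => g (i₀, j)) (𝒰 : Filter (Fin m → 𝕄)) ⊓
    Filter.principal {y | ∀ i, y i ∈ Ms}
  have : (typeFilter L Ms J ⊓ F).NeBot := by
    refine Filter.inf_neBot_iff.2 ?_
    rintro X ⟨S, hS, hJS, hSX⟩ Y hY
    obtain ⟨U, hU, hUY⟩ := Filter.mem_comap.1 (Filter.mem_inf_principal.1 hY)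
    have h1 : (fun g => g ∘ Prod.mk i₀) '' S ∈ 𝒰 :=
      (hJ.mem_iff (definable_image hS (Prod.mk i₀))).1 ⟨J, hJS, rfl⟩
    obtain ⟨y, ⟨hyU, g, hg, rfl⟩, hyM⟩ := 𝒰.nonempty_of_mem
      (Filter.inter_mem (Filter.inter_mem hU h1) hconc)
    have h2 : Ms.Definable L (S ∩ ⋂ j, {h : ι × Fin m → 𝕄 | h (i₀, j) = g (i₀, j)}) :=
      hS.inter (Set.definable_iInter_of_finite fun j => definable_eq_const _ (hyM j))
    obtain ⟨h, ⟨hh, hh'⟩, hhM⟩ := exists_mem_of_definable hMs h2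
      ⟨g, hg, Set.mem_iInter.2 fun j => rfl⟩
    refine ⟨h, hSX hh, hUY ?_ hhM⟩
    have : (fun j => h (i₀, j)) = g ∘ Prod.mk i₀ := funext fun j => Set.mem_iInter.1 hh' j
    rw [Set.mem_preimage, this]
    exact hyU
  obtain ⟨𝒲, h𝒲⟩ := Ultrafilter.exists_le (typeFilter L Ms J ⊓ F)
  exact ⟨𝒲, (h𝒲.trans (inf_le_right.trans inf_le_right)) (Filter.mem_principal_self _),
    realizesFilter_of_le_typeFilter (h𝒲.trans inf_le_left), fun S hS =>
    (h𝒲.trans (inf_le_right.trans inf_le_left)) (Filter.preimage_mem_comap hS)⟩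

theorem CanonicalTuple.flatSeq (hm : IsMonster L 𝕄 κ) (hMs : IsElemSubmodel L Ms)
    (hMs' : Cardinal.mk Ms < κ) (hR : R.CoheirChain κ) {ι : Type u} [Countable ι]
    {I : ℕ → ι × Fin m → 𝕄} (hJ : CanonicalTuple R κ Ms (𝒱 : Filter (Fin m → 𝕄)) (I 0))
    (𝒲 : Ultrafilter (ι × Fin m → 𝕄)) (hconc : Concentrates (𝒲 : Filter (ι × Fin m → 𝕄)) Ms)
    (hI : ∀ i, RealizesFilter L (𝒲 : Filter (ι × Fin m → 𝕄))
      (Ms ∪ ⋃ (j : ℕ) (_ : j < i), Set.range (I j)) (I i)) :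
    CanonicalTuple R κ Ms (𝒱 : Filter (Fin m → 𝕄))
      (fun p : (ℕ × ι) × Fin m => I p.1.1 (p.1.2, p.2)) := by
  intro β hβ d
  have hι : Cardinal.mk (ι × Fin m) < κ := lt_of_le_of_lt Cardinal.mk_le_aleph0 hm.1
  obtain ⟨J', h1, h2, h3⟩ := hJ β hβ d
  obtain ⟨σ, hσ, hσ'⟩ := exists_aut_of_eqTpOver hm hMs' hι h1
  let I₁ : ℕ → ι × Fin m → 𝕄 := fun n p => σ (I n p)
  have hI₁ : EqTpOver L Ms (NSOP2Paper.flatSeq I) (NSOP2Paper.flatSeq I₁) := eqTpOver_aut σ hσ _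
  obtain ⟨I', h4, h5, h6⟩ := hR Ms hMs hMs' β _ hβ hι d J' h2 I₁
    (coheirMorley_of_realizesFilter 𝒲 hconc hI hI₁) (funext hσ')
  refine ⟨fun p => I' p.1.1 (p.1.2, p.2), ?_, ?_, fun i => ?_⟩
  · exact (hI₁.trans h4.symm).comp fun p : (ℕ × ι) × Fin m => (p.1.1, (p.1.2, p.2))
  · convert h5 using 1
    ext x
    simp
  · exact (h3 i.2).of_eqTpOver ((h6 i.1).symm.comp (Prod.mk i.2))

end Monster

/-! ### Canonical trees -/

section CanonicalTree

variable {L : FirstOrder.Language.{u, u}} {𝕄 : Type u} [L.Structure 𝕄] {κ : Cardinal.{u}}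
  {R : IndRel L 𝕄} {Ms : Set 𝕄} {m : ℕ} {𝒱 : Ultrafilter (Fin m → 𝕄)}

/-- The first `n` terms of `x` and `y` have the same type over `Ms`. -/
def EqTpSeq (L : FirstOrder.Language.{u, u}) {𝕄 : Type u} [L.Structure 𝕄] (Ms : Set 𝕄) {m : ℕ}
    (n : ℕ) (x y : ℕ → Fin m → 𝕄) : Prop :=
  EqTpOver L Ms (fun p : Fin n × Fin m => x p.1 p.2) fun p => y p.1 p.2

theorem EqTpSeq.zero (x y : ℕ → Fin m → 𝕄) : EqTpSeq L Ms 0 x y := by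
  have : (fun p : Fin 0 × Fin m => x p.1 p.2) = fun p => y p.1 p.2 := Subsingleton.elim _ _
  rw [EqTpSeq, this]
  exact EqTpOver.refl _

theorem EqTpSeq.succ {n : ℕ} {x y : ℕ → Fin m → 𝕄} (h : EqTpSeq L Ms n x y)
    (hconc : Concentrates (𝒱 : Filter (Fin m → 𝕄)) Ms)
    (hx : RealizesFilter L (𝒱 : Filter (Fin m → 𝕄))
      (Ms ∪ ⋃ (j : ℕ) (_ : j < n), Set.range (x j)) (x n))
    (hy : RealizesFilter L (𝒱 : Filter (Fin m → 𝕄))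
      (Ms ∪ ⋃ (j : ℕ) (_ : j < n), Set.range (y j)) (y n)) :
    EqTpSeq L Ms (n + 1) x y := by
  rw [biUnion_range_eq] at hx hy
  have h1 := (eqTpOver_sumElim hconc h hx hy).comp fun p : Fin (n + 1) × Fin m =>
    if hp : p.1.1 < n then Sum.inr ((⟨p.1.1, hp⟩ : Fin n), p.2) else Sum.inl p.2
  have key : ∀ z : ℕ → Fin m → 𝕄, (Sum.elim (z n) (fun p : Fin n × Fin m => z p.1 p.2) ∘
      fun p : Fin (n + 1) × Fin m =>
        if hp : p.1.1 < n then Sum.inr ((⟨p.1.1, hp⟩ : Fin n), p.2) else Sum.inl p.2) =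
      fun p => z p.1 p.2 := by
    intro z
    funext p
    by_cases hp : p.1.1 < n
    · simp [hp]
    · have : p.1.1 = n := by omega
      simp [this]
  rwa [key, key] at h1

theorem EqTpSeq.congr_left {n : ℕ} {x x' y : ℕ → Fin m → 𝕄} (h : EqTpSeq L Ms n x y)
    (hx : ∀ j < n, x' j = x j) : EqTpSeq L Ms n x' y := by
  have : (fun p : Fin n × Fin m => x' p.1 p.2) = fun p => x p.1 p.2 :=
    funext fun p => by rw [hx p.1 p.1.2]
  rw [EqTpSeq, this]
  exact h

theorem exists_canonical_tree (hm : IsMonster L 𝕄 κ) (hMs : IsElemSubmodel L Ms)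
    (hMs' : Cardinal.mk Ms < κ) (hR : R.StrongerThanH) (hR' : R.CoheirChain κ)
    (hconc : Concentrates (𝒱 : Filter (Fin m → 𝕄)) Ms)
    (hcan : ∀ (β : Type u), Cardinal.mk β < κ → ∀ (d : β → 𝕄) (c : Fin m → 𝕄),
      RealizesFilter L (𝒱 : Filter (Fin m → 𝕄)) (Ms ∪ Set.range d) c →
        R.rel (Set.range d) Ms (Set.range c))
    {b : Fin m → 𝕄} (hb : RealizesFilter L (𝒱 : Filter (Fin m → 𝕄)) Ms b)
    (b' : ℕ → Fin m → 𝕄) (n : ℕ)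
    (hfs : ∀ i < n, FinSatIn L Ms (b' i) (Ms ∪ ⋃ (j : ℕ) (_ : j < i), Set.range (b' j)))
    (hb' : ∀ i < n, EqTpOver L Ms (b' i) b) :
    ∃ (ι : Type u) (_ : Countable ι) (J : ι × Fin m → 𝕄) (t : List Bool → ι),
      CanonicalTuple R κ Ms (𝒱 : Filter (Fin m → 𝕄)) J ∧
      (∀ η : List Bool, η.length = n → EqTpSeq L Ms n (fun j i => J (t (η.take (n - 1 - j)), i)) b') ∧
      ∀ u a : List Bool, u ++ [true] <+: a → a.length < n → RealizesFilter L (𝒱 : Filter (Fin m → 𝕄))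
        (Ms ∪ Set.range fun p : {x // u ++ [false] <+: x ∧ x.length < n} × Fin m => J (t p.1, p.2))
        fun i => J (t a, i) := by
  induction n with
  | zero =>
    exact ⟨PUnit, inferInstance, _, fun _ => PUnit.unit, exists_canonicalTuple hm hMs' hcan hb,
      fun η _ => EqTpSeq.zero _ _, fun u a _ ha => absurd ha (Nat.not_lt_zero _)⟩
  | succ n ih =>
    obtain ⟨ι, _, J, t, hJ, hP, hV⟩ := ih (fun i hi => hfs i (by omega))
      fun i hi => hb' i (by omega)
    obtain ⟨𝒲, hWc, hWJ, hW⟩ := hJ.exists_ultrafilter hm hMs hR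
    obtain ⟨I, hI0, hI⟩ := exists_morley hm hMs' 𝒲 hWJ
    have hJ₁ := CanonicalTuple.flatSeq hm hMs hMs' hR' (hI0 ▸ hJ) 𝒲 hWc hI
    set J₁ : (ℕ × ι) × Fin m → 𝕄 := fun p => I p.1.1 (p.1.2, p.2)
    have hIJ : ∀ c, EqTpOver L Ms J (I c) := fun c =>
      hWJ.eqTpOver ((hI c).mono Set.subset_union_left)
    obtain ⟨𝒰, hUc, hU⟩ := exists_realizesFilter_of_finSatIn (hfs n (by omega))
    let i₀ : ℕ × ι := (0, t [])
    have hi₀ : RealizesFilter L (𝒰 : Filter (Fin m → 𝕄)) Ms fun j => J₁ (i₀, j) :=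
      (hU.mono Set.subset_union_left).of_eqTpOver
        ((hb' n (by omega)).trans (hb.eqTpOver (hJ₁.realizesFilter hm i₀)))
    obtain ⟨𝒲', hWc', hWJ', hW'⟩ := exists_ultrafilter_extending hMs J₁ i₀ 𝒰 hUc hi₀
    obtain ⟨I', hI0', hI'⟩ := exists_morley hm hMs' 𝒲' hWJ'
    have hJ₂ := CanonicalTuple.flatSeq hm hMs hMs' hR' (hI0' ▸ hJ₁) 𝒲' hWc' hI'
    set J₂ : (ℕ × (ℕ × ι)) × Fin m → 𝕄 := fun p => I' p.1.1 (p.1.2, p.2)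
    let side : Bool → ℕ := fun c => cond c 1 0
    let t' : List Bool → ℕ × (ℕ × ι) := fun η => match η with
      | [] => (1, i₀)
      | c :: η => (0, (side c, t η))
    have hcopy : ∀ c η i, J₂ (t' (c :: η), i) = I (side c) (t η, i) := by
      intro c η i
      change I' 0 ((side c, t η), i) = _
      rw [hI0']
    have hroot : RealizesFilter L (𝒰 : Filter (Fin m → 𝕄)) (Ms ∪ Set.range J₁)
        fun i => J₂ (t' [], i) := by
      have h1 : RealizesFilter L (𝒲' : Filter ((ℕ × ι) × Fin m → 𝕄)) (Ms ∪ Set.range J₁)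
          (I' 1) := by
        refine (hI' 1).mono (Set.union_subset_union_right _ ?_)
        rw [← hI0']
        exact Set.subset_biUnion_of_mem (u := fun j => Set.range (I' j))
          (show (0 : ℕ) ∈ {j | j < 1} from Nat.one_pos)
      exact h1.comp (Prod.mk i₀) fun S _ hS => hW' S hS
    refine ⟨ℕ × (ℕ × ι), inferInstance, J₂, t', hJ₂, ?_, ?_⟩
    · rintro (_ | ⟨c, η⟩) hη
      · simp at hη
      have hη : η.length = n := by simpa using hη
      have htake : ∀ j < n, (c :: η).take (n + 1 - 1 - j) = c :: η.take (n - 1 - j) := by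
        intro j hj
        rw [show n + 1 - 1 - j = (n - 1 - j) + 1 by omega, List.take_succ_cons]
      refine EqTpSeq.succ (𝒱 := 𝒰) ?_ hUc ?_ hU
      · refine EqTpSeq.congr_left (x := fun j i => I (side c) (t (η.take (n - 1 - j)), i)) ?_ ?_
        · exact ((hIJ (side c)).symm.comp fun p : Fin n × Fin m =>
            (t (η.take (n - 1 - p.1)), p.2)).trans (hP η hη)
        · intro j hj
          funext i
          rw [htake j hj, hcopy]
      · simp only [Nat.add_sub_cancel, Nat.sub_self, List.take_zero]
        refine hroot.mono (Set.union_subset_union_right _ ?_)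
        refine Set.iUnion₂_subset fun j hj => ?_
        rintro _ ⟨i, rfl⟩
        have := htake j hj
        simp only [Nat.add_sub_cancel] at this
        rw [this]
        exact ⟨((side c, _), i), (hcopy c _ i).symm⟩
    · rintro (_ | ⟨c, u⟩) a ha hlen
      · obtain ⟨a, rfl⟩ := ha
        have h1 : RealizesFilter L (𝒱 : Filter (Fin m → 𝕄)) (Ms ∪ Set.range (I 0))
            (I 1 ∘ Prod.mk (t a)) := by
          refine RealizesFilter.comp ((hI 1).mono (Set.union_subset_union_right _ ?_)) _
            fun S hS hS𝒱 => hW (t a) _ S hS hS𝒱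
          exact Set.subset_biUnion_of_mem (u := fun j => Set.range (I j))
            (show (0 : ℕ) ∈ {j | j < 1} from Nat.one_pos)
        have h2 : (fun i => J₂ (t' ([] ++ [true] ++ a), i)) = I 1 ∘ Prod.mk (t a) :=
          funext fun i => hcopy true a i
        rw [h2]
        refine h1.mono (Set.union_subset_union_right _ ?_)
        rintro _ ⟨⟨⟨x, ⟨x, rfl⟩, hx⟩, i⟩, rfl⟩
        exact ⟨(t x, i), (hcopy false x i).symm⟩
      · obtain ⟨a, rfl⟩ := ha
        have h1 := hV u (u ++ [true] ++ a) ⟨a, rfl⟩ (by simpa using hlen)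
        have h2 := RealizesFilter.transfer hconc (hIJ (side c)) (Prod.mk (t (u ++ [true] ++ a)))
          (fun p : {x // u ++ [false] <+: x ∧ x.length < n} × Fin m => (t p.1, p.2)) h1
        have h3 : (fun i => J₂ (t' (c :: u ++ [true] ++ a), i)) =
            I (side c) ∘ Prod.mk (t (u ++ [true] ++ a)) :=
          funext fun i => hcopy c (u ++ [true] ++ a) i
        rw [h3]
        refine h2.mono (Set.union_subset_union_right _ ?_)
        rintro _ ⟨⟨⟨x, ⟨x, rfl⟩, hx⟩, i⟩, rfl⟩
        exact ⟨(⟨u ++ [false] ++ x, ⟨x, rfl⟩, by simpa using hx⟩, i),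
          (hcopy c (u ++ [false] ++ x) i).symm⟩

end CanonicalTree

theorem RealizesType.finSatIn {L : FirstOrder.Language.{u, u}} {𝕄 : Type u} [L.Structure 𝕄]
    {α : Type v} {q : GlobalType L 𝕄 α} {Ms C : Set 𝕄} (hq : q.FinSatInM Ms) {a : α → 𝕄}
    (ha : RealizesType q a C) : FinSatIn L Ms a C := by
  intro n φ c hc h
  have hφ : (⟨n, φ, c⟩ : FmlP L 𝕄 α) ∈ q.carrier :=
    (q.complete n φ c).resolve_right fun hn => ha n φ.not c hc hn h
  obtain ⟨y, hy, hy'⟩ := hq {⟨n, φ, c⟩} (by simpa using hφ)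
  exact ⟨y, hy, hy' _ (Finset.mem_singleton_self _)⟩

theorem FinSatIn.mono {L : FirstOrder.Language.{u, u}} {𝕄 : Type u} [L.Structure 𝕄]
    {α : Type v} {Ms C C' : Set 𝕄} {a : α → 𝕄} (h : FinSatIn L Ms a C) (hC : C' ⊆ C) :
    FinSatIn L Ms a C' :=
  fun n φ c hc => h n φ c fun i => hC (hc i)

theorem IsMonster.hasSOP2_of_canonical_trees {L : FirstOrder.Language.{u, u}} {𝕄 : Type u}
    [L.Structure 𝕄] {κ : Cardinal.{u}} (hm : IsMonster L 𝕄 κ) {R : IndRel L 𝕄}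
    (hR : R.StrongerThanH) (hR' : R.CoheirChain κ) {Ms : Set 𝕄} (hMs : IsElemSubmodel L Ms)
    (hMs' : Cardinal.mk Ms < κ) {r s m : ℕ} (ψ : L.Formula (Fin r ⊕ (Fin s ⊕ Fin m)))
    (e : Fin s → 𝕄) (he : ∀ i, e i ∈ Ms) (k : ℕ)
    (h : ∀ N : ℕ, ∃ (q : GlobalType L 𝕄 (Fin m)) (B b' : ℕ → Fin m → 𝕄),
      IsCanonicalGlobal R κ Ms q ∧ MorleyIn q Ms B ∧
      (¬ ∃ a : Fin r → 𝕄, ∀ i < k, ψ.Realize (Sum.elim a (Sum.elim e (B i)))) ∧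
      (∀ i < N, FinSatIn L Ms (b' i) (Ms ∪ ⋃ (j : ℕ) (_ : j < i), Set.range (b' j))) ∧
      (∀ i < N, EqTpOver L Ms (b' i) (B 0)) ∧
      ∃ a : Fin r → 𝕄, ∀ i < N, ψ.Realize (Sum.elim a (Sum.elim e (b' i)))) :
    HasSOP2 L 𝕄 := by
  have hΦ : (∅ : Set 𝕄).Definable L {g : Fin r ⊕ (Fin s ⊕ Fin m) → 𝕄 | ψ.Realize g} :=
    Set.empty_definable_iff.2 ⟨ψ, rfl⟩
  have hΦe : Ms.Definable L {g : Fin r ⊕ Fin m → 𝕄 |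
      ψ.Realize (Sum.elim (g ∘ Sum.inl) (Sum.elim e (g ∘ Sum.inr)))} := by
    refine (congrArg (Ms.Definable L) ?_).mp (definable_subst (hΦ.mono (Set.empty_subset Ms))
      (β := Fin r ⊕ Fin m) (Sum.elim (Sum.inr ∘ Sum.inl)
        (Sum.elim (fun i => Sum.inl ⟨e i, he i⟩) (Sum.inr ∘ Sum.inr))))
    ext g
    refine iff_of_eq (congrArg ψ.Realize ?_)
    funext i
    rcases i with i | i | i <;> rfl
  have hcons : ∀ (n : ℕ) (x y : ℕ → Fin m → 𝕄), EqTpSeq L Ms n x y →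
      ((∃ a : Fin r → 𝕄, ∀ i < n, ψ.Realize (Sum.elim a (Sum.elim e (x i)))) ↔
        ∃ a : Fin r → 𝕄, ∀ i < n, ψ.Realize (Sum.elim a (Sum.elim e (y i)))) := by
    intro n x y hxy
    have key : ∀ z : ℕ → Fin m → 𝕄,
        (∃ a : Fin r → 𝕄, ∀ i < n, ψ.Realize (Sum.elim a (Sum.elim e (z i)))) ↔
          ∃ a : Fin r → 𝕄, ∀ i ∈ (Finset.univ : Finset (Fin n)),
            ψ.Realize (Sum.elim a (Sum.elim e (z i))) := fun z =>
      exists_congr fun a => ⟨fun H i _ => H i i.2, fun H i hi => H ⟨i, hi⟩ (Finset.mem_univ _)⟩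
    rw [key, key]
    exact eqTpOver_iff.1 hxy _ (definable_consistent hΦe Finset.univ)
  refine hasSOP2_of_comb hm.1 hm.2.1 k hΦ fun n => ?_
  obtain ⟨q, B, b', hq, hB, hinc, hfs, hb', hcon⟩ := h n
  obtain ⟨𝒱, hconc, h𝒱⟩ := exists_ultrafilter_of_globalType hB.1
  have hB' := fun i => (h𝒱 _ _).1 (hB.2 i)
  obtain ⟨ι, _, J, t, hJ, hP, hV⟩ := exists_canonical_tree hm hMs hMs' hR hR' hconc
    (fun β hβ d c hc => hq β hβ d c ((h𝒱 _ _).2 hc)) ((hB' 0).mono Set.subset_union_left)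
    b' n hfs hb'
  refine ⟨fun η => Sum.elim e fun i => J (t η, i), fun w hw => ?_, fun d hd hlen => ?_⟩
  · have hw' : (w ++ List.replicate (n - w.length) true).length = n := by simp; omega
    obtain ⟨a, ha⟩ := (hcons _ _ _ (hP _ hw')).2 hcon
    refine ⟨a, fun x hx => ?_⟩
    have hxl := hx.length_le
    have h1 := ha (n - 1 - x.length) (by omega)
    rw [show n - 1 - (n - 1 - x.length) = x.length by omega,
      List.take_append_of_le_length hxl, ← List.prefix_iff_eq_take.1 hx] at h1
    exact h1
  · have hseq : ∀ l ≤ k, EqTpSeq L Ms l (fun j i => J (t (d j), i)) B := by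
      intro l
      induction l with
      | zero => exact fun _ => EqTpSeq.zero _ _
      | succ l ih =>
        intro hl
        refine (ih (by omega)).succ hconc ?_ (hB' l)
        rcases Nat.eq_zero_or_pos l with rfl | h0
        · simpa using hJ.realizesFilter hm (t (d 0))
        · obtain ⟨v, hv, hv'⟩ := hd l (by omega) h0
          refine (hV v (d l) hv' (hlen l (by omega))).mono (Set.union_subset_union_right _ ?_)
          refine Set.iUnion₂_subset fun j hj => ?_
          rintro _ ⟨i, rfl⟩
          exact ⟨(⟨d j, hv j hj, hlen j (by omega)⟩, i), rfl⟩
    exact fun H => hinc ((hcons k _ _ (hseq k le_rfl)).1 H)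

/-- **Theorem 4.3 (Kim's lemma for canonical Morley sequences).** Let `T` be
`NSOP₂`, `b` a tuple, `φ(x,y)` a formula over `M` (an `L`-formula `ψ` with a
parameter tuple `e` from `M`), and `q` a canonical coheir of `tp(b/M)`.
If some canonical Morley sequence in `q` starting with `b` witnesses
Kim-dividing of `φ(x,b)` over `M` with `{φ(x,bᵢ)}` `k`-inconsistent, then
there is a finite bound `N`, depending only on `φ(x,y)` and `k`, on the length
of a coheir sequence over `M` of realizations of `tp(b/M)` on which `φ` is
consistent.  In particular every coheir Morley sequence over `M` starting with
`b` witnesses Kim-dividing of `φ(x,b)` over `M`. -/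
theorem kims_lemma_for_canonical_morley (L : FirstOrder.Language.{u, u}) (𝕄 : Type u)
    [L.Structure 𝕄] (κ : Cardinal.{u}) (hmonster : IsMonster L 𝕄 κ)
    (hNSOP2 : ¬ HasSOP2 L 𝕄)
    (R : IndRel L 𝕄) (hCK : IsCK R κ)
    (Ms : Set 𝕄) (hMs : IsElemSubmodel L Ms) (hMssmall : Cardinal.mk Ms < κ)
    (r s m : ℕ) (ψ : L.Formula (Fin r ⊕ (Fin s ⊕ Fin m))) (e : Fin s → 𝕄)
    (he : ∀ i, e i ∈ Ms) (k : ℕ) :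
    ∃ N : ℕ, ∀ (b : Fin m → 𝕄) (q : GlobalType L 𝕄 (Fin m)),
      ExtendsTpOver q Ms b → IsCanonicalGlobal R κ Ms q →
      (∃ B : ℕ → Fin m → 𝕄, MorleyIn q Ms B ∧ B 0 = b ∧
        ∀ t : Finset ℕ, t.card = k →
          ¬ ∃ a : Fin r → 𝕄, ∀ i ∈ t, ψ.Realize (Sum.elim a (Sum.elim e (B i)))) →
      (∀ (n : ℕ) (b' : Fin n → Fin m → 𝕄),
        (∀ i : Fin n, FinSatIn L Ms (b' i)
          (Ms ∪ ⋃ (j : Fin n) (_ : j < i), Set.range (b' j))) →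
        (∀ i, EqTpOver L Ms (b' i) b) →
        (∃ a : Fin r → 𝕄, ∀ i, ψ.Realize (Sum.elim a (Sum.elim e (b' i)))) → n ≤ N) ∧
      (∀ B' : ℕ → Fin m → 𝕄, CoheirMorley L Ms B' → B' 0 = b →
        ¬ ∃ a : Fin r → 𝕄, ∀ i : ℕ, ψ.Realize (Sum.elim a (Sum.elim e (B' i)))) := by
  have hbound : ∃ N : ℕ, ∀ (b : Fin m → 𝕄) (q : GlobalType L 𝕄 (Fin m)),
      IsCanonicalGlobal R κ Ms q →
      (∃ B : ℕ → Fin m → 𝕄, MorleyIn q Ms B ∧ B 0 = b ∧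
        ∀ t : Finset ℕ, t.card = k →
          ¬ ∃ a : Fin r → 𝕄, ∀ i ∈ t, ψ.Realize (Sum.elim a (Sum.elim e (B i)))) →
      ∀ (n : ℕ) (b' : Fin n → Fin m → 𝕄),
        (∀ i : Fin n, FinSatIn L Ms (b' i)
          (Ms ∪ ⋃ (j : Fin n) (_ : j < i), Set.range (b' j))) →
        (∀ i, EqTpOver L Ms (b' i) b) →
        (∃ a : Fin r → 𝕄, ∀ i, ψ.Realize (Sum.elim a (Sum.elim e (b' i)))) → n ≤ N := by
    by_contra hN
    refine hNSOP2 (hmonster.hasSOP2_of_canonical_trees hCK.1.1 hCK.1.2.2.2.2.2 hMs hMssmall ψ e he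
      k fun N => ?_)
    push Not at hN
    obtain ⟨b, q, hq, ⟨B, hB, rfl, hinc⟩, n, b', hfs, hb', ⟨a, ha⟩, hn⟩ := hN N
    let c : ℕ → Fin m → 𝕄 := fun i => if hi : i < n then b' ⟨i, hi⟩ else B 0
    have hc : ∀ i (hi : i < n), c i = b' ⟨i, hi⟩ := fun i hi => dif_pos hi
    refine ⟨q, B, c, hq, hB, ?_, fun i hi => ?_, fun i hi => ?_, a, fun i hi => ?_⟩
    · rintro ⟨a, ha⟩
      obtain ⟨i, hi, hi'⟩ := hinc (Finset.range k) (Finset.card_range k) a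
      exact hi' (ha i (Finset.mem_range.1 hi))
    · rw [hc i (hi.trans hn)]
      refine (hfs _).mono (Set.union_subset_union_right _ (Set.iUnion₂_subset fun j hj => ?_))
      rw [hc j (hj.trans (hi.trans hn))]
      exact Set.subset_biUnion_of_mem (u := fun j => Set.range (b' j))
        (show (⟨j, _⟩ : Fin n) ∈ {j : Fin n | j < ⟨i, hi.trans hn⟩} from hj)
    · rw [hc i (hi.trans hn)]
      exact hb' _
    · rw [hc i (hi.trans hn)]
      exact ha _
  obtain ⟨N, hN⟩ := hbound
  refine ⟨N, fun b q _ hq hB => ⟨hN b q hq hB, ?_⟩⟩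
  rintro B' ⟨q', hq', hB'⟩ rfl ⟨a, ha⟩
  obtain ⟨𝒱, -, h𝒱⟩ := exists_ultrafilter_of_globalType hq'
  have hreal := fun i => ((h𝒱 _ _).1 (hB' i)).mono Set.subset_union_left
  refine absurd (hN _ q hq hB (N + 1) (fun i => B' i) (fun i => ?_)
    (fun i => (hreal i).eqTpOver (hreal 0)) ⟨a, fun i => ha i⟩) (by omega)
  refine ((hB' i).finSatIn hq').mono (Set.union_subset_union_right _
    (Set.iUnion₂_subset fun j hj => ?_))
  exact Set.subset_biUnion_of_mem (u := fun j => Set.range (B' j))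
    (show (j : ℕ) ∈ {j : ℕ | j < i} from hj)

end NSOP2Paper
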